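/- arXiv:1504.06683 — 2 statements merged into one kernel-verified Lean document; each statement's English description precedes it below -/
import Mathlib

section
/- Assume that u ↦ Ef(x,u) is closed for every x ∈ 𝓝, that φ is proper, that ∂φ(u) ≠ ∅, and that for every y ∈ ∂φ(u) there exists v ∈ 𝓝^⊥ with φ*(y) = Ef*(v,y). Then x ∈ 𝓝 solves (P_u) if and only if x is feasible and there exist y ∈ 𝓨 and v ∈ 𝓝^⊥ such that (v(ω),y(ω)) ∈ ∂f(x(ω),u(ω),ω) for P-almost every ω. -/
open MeasureTheory
open scoped ENNReal

noncomputable section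

/-- The positive part of an extended real number, as an extended nonnegative real. -/
def epos (a : EReal) : ℝ≥0∞ := if a = ⊤ then ⊤ else ENNReal.ofReal a.toReal

/-- Expectation of an extended-real-valued function: it equals `+∞` unless the positive
part is integrable, in which case it is the usual (possibly `-∞`) integral. -/
def EE {Ω : Type} [MeasurableSpace Ω] (P : Measure Ω) (φ : Ω → EReal) : EReal :=
  if ∫⁻ ω, epos (φ ω) ∂P = ⊤ then ⊤
  else ((∫⁻ ω, epos (φ ω) ∂P : ℝ≥0∞) : EReal) - ((∫⁻ ω, epos (-(φ ω)) ∂P : ℝ≥0∞) : EReal)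

/-- `ℝ^n` viewed as `ℝ^{n_0} × ⋯ × ℝ^{n_T}`. -/
abbrev Vec {T : ℕ} (nt : Fin (T+1) → ℕ) : Type := (t : Fin (T+1)) → Fin (nt t) → ℝ

/-- `x·v = Σ_t x_t·v_t`. -/
def dotN {T : ℕ} (nt : Fin (T+1) → ℕ) (a b : Vec nt) : ℝ := ∑ t, ∑ i, a t i * b t i

/-- The scalar product on `ℝ^m`. -/
def dotM {m : ℕ} (a b : Fin m → ℝ) : ℝ := ∑ j, a j * b j

variable {Ω : Type} [MeasurableSpace Ω] {T : ℕ} {nt : Fin (T+1) → ℕ} {m : ℕ}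

/-- The space `𝓝` of adapted strategies. -/
def Nspace (nt : Fin (T+1) → ℕ) (ℱ : Fin (T+1) → MeasurableSpace Ω) :
    Set (Ω → Vec nt) := {x | ∀ t, Measurable[ℱ t] (fun ω => x ω t)}

/-- The space `𝓝^∞` of essentially bounded adapted strategies. -/
def NspaceInf (nt : Fin (T+1) → ℕ) (ℱ : Fin (T+1) → MeasurableSpace Ω)
    (P : Measure Ω) : Set (Ω → Vec nt) :=
  {x | x ∈ Nspace nt ℱ ∧ ∃ M : ℝ, ∀ᵐ ω ∂P, ‖x ω‖ ≤ M}

/-- The annihilator `𝓝^⊥` of `𝓝^∞` in `L¹`. -/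
def Nperp (nt : Fin (T+1) → ℕ) (ℱ : Fin (T+1) → MeasurableSpace Ω)
    (P : Measure Ω) : Set (Ω → Vec nt) :=
  {v | Measurable v ∧ Integrable v P ∧
    ∀ x ∈ NspaceInf nt ℱ P, ∫ ω, dotN nt (x ω) (v ω) ∂P = 0}

/-- `Ef(x,u)`. -/
def intF (P : Measure Ω) (f : Vec nt → (Fin m → ℝ) → Ω → EReal)
    (x : Ω → Vec nt) (u : Ω → Fin m → ℝ) : EReal :=
  EE P (fun ω => f (x ω) (u ω) ω)

/-- The bilinear pairing `⟨u,y⟩ = E(u·y)`. -/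
def pairing (P : Measure Ω) (u y : Ω → Fin m → ℝ) : ℝ := ∫ ω, dotM (u ω) (y ω) ∂P

/-- The value function `φ(u) = inf_{x∈𝓝} Ef(x,u)`. -/
def valueFn (P : Measure Ω) (f : Vec nt → (Fin m → ℝ) → Ω → EReal)
    (ℱ : Fin (T+1) → MeasurableSpace Ω) (u : Ω → Fin m → ℝ) : EReal :=
  ⨅ x ∈ Nspace nt ℱ, intF P f x u

/-- The auxiliary value function `φ̃(u) = inf_{x∈𝓝^∞} Ef(x,u)`. -/
def valueFnInf (P : Measure Ω) (f : Vec nt → (Fin m → ℝ) → Ω → EReal)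
    (ℱ : Fin (T+1) → MeasurableSpace Ω) (u : Ω → Fin m → ℝ) : EReal :=
  ⨅ x ∈ NspaceInf nt ℱ P, intF P f x u

/-- The conjugate on `𝓨` of a function `g` on `𝓤`. -/
def conj (P : Measure Ω) (𝓤 : Set (Ω → Fin m → ℝ)) (g : (Ω → Fin m → ℝ) → EReal)
    (y : Ω → Fin m → ℝ) : EReal :=
  ⨆ u ∈ 𝓤, (((pairing P u y : ℝ) : EReal) - g u)

/-- The Lagrangian integrand `l(x,y,ω) = inf_u {f(x,u,ω) − u·y}`. -/
def lagr (f : Vec nt → (Fin m → ℝ) → Ω → EReal) (x : Vec nt) (y : Fin m → ℝ)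
    (ω : Ω) : EReal :=
  ⨅ u : Fin m → ℝ, (f x u ω - ((dotM u y : ℝ) : EReal))

/-- `El(x,y)`. -/
def intL (P : Measure Ω) (f : Vec nt → (Fin m → ℝ) → Ω → EReal)
    (x : Ω → Vec nt) (y : Ω → Fin m → ℝ) : EReal :=
  EE P (fun ω => lagr f (x ω) (y ω) ω)

/-- The pointwise conjugate `f*(v,y,ω)`. -/
def fconj (f : Vec nt → (Fin m → ℝ) → Ω → EReal) (v : Vec nt) (y : Fin m → ℝ)
    (ω : Ω) : EReal :=
  ⨆ x : Vec nt, ⨆ u : Fin m → ℝ, (((dotN nt x v + dotM u y : ℝ) : EReal) - f x u ω)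

/-- `Ef*(v,y)`. -/
def intFconj (P : Measure Ω) (f : Vec nt → (Fin m → ℝ) → Ω → EReal)
    (v : Ω → Vec nt) (y : Ω → Fin m → ℝ) : EReal :=
  EE P (fun ω => fconj f (v ω) (y ω) ω)

/-- `l̲(x,y,ω) = sup_v {x·v − f*(v,y,ω)}`. -/
def lagrLow (f : Vec nt → (Fin m → ℝ) → Ω → EReal) (x : Vec nt) (y : Fin m → ℝ)
    (ω : Ω) : EReal :=
  ⨆ v : Vec nt, (((dotN nt x v : ℝ) : EReal) - fconj f v y ω)

/-- `El̲(x,y)`. -/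
def intLlow (P : Measure Ω) (f : Vec nt → (Fin m → ℝ) → Ω → EReal)
    (x : Ω → Vec nt) (y : Ω → Fin m → ℝ) : EReal :=
  EE P (fun ω => lagrLow f (x ω) (y ω) ω)

/-- `dom₁ Ef = {x ∈ 𝓝 : Ef(x,u) < +∞ for some u ∈ 𝓤}`. -/
def dom1intF (P : Measure Ω) (f : Vec nt → (Fin m → ℝ) → Ω → EReal)
    (ℱ : Fin (T+1) → MeasurableSpace Ω) (𝓤 : Set (Ω → Fin m → ℝ)) :
    Set (Ω → Vec nt) :=
  {x | x ∈ Nspace nt ℱ ∧ ∃ u ∈ 𝓤, intF P f x u < ⊤}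

/-- The algebraic closure of a convex set in a real vector space. -/
def acl {A : Type} [AddCommGroup A] [Module ℝ A] (C : Set A) : Set A :=
  {x | ∃ z ∈ C, ∀ lam : ℝ, 0 < lam → lam ≤ 1 → ((1 - lam) • x + lam • z) ∈ C}

/-- Decomposability of a set of measurable functions. -/
def Decomposable (P : Measure Ω) (𝓤 : Set (Ω → Fin m → ℝ)) : Prop :=
  ∀ A : Set Ω, MeasurableSet A → ∀ u ∈ 𝓤, ∀ u' : Ω → Fin m → ℝ,
    Measurable u' → (∃ M : ℝ, ∀ᵐ ω ∂P, ‖u' ω‖ ≤ M) →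
    (fun ω => A.indicator u ω + Aᶜ.indicator u' ω) ∈ 𝓤

end

/-- The weak topology `σ(𝓤,𝓨)` on `𝓤`. -/
noncomputable def weakTop {Ω : Type} [MeasurableSpace Ω] {m : ℕ} (P : Measure Ω)
    (𝓤 𝓨 : Set (Ω → Fin m → ℝ)) : TopologicalSpace {u // u ∈ 𝓤} :=
  TopologicalSpace.induced
    (fun u : {u // u ∈ 𝓤} => fun y : {y // y ∈ 𝓨} => pairing P u.1 y.1) Pi.topologicalSpace

/-- A function on `𝓤` is closed if it is `σ(𝓤,𝓨)`-lower semicontinuous and either proper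
or constant. -/
def ClosedFn {Ω : Type} [MeasurableSpace Ω] {m : ℕ} (P : Measure Ω)
    (𝓤 𝓨 : Set (Ω → Fin m → ℝ)) (g : (Ω → Fin m → ℝ) → EReal) : Prop :=
  (@LowerSemicontinuous _ _ (weakTop P 𝓤 𝓨) _ (fun u : {u // u ∈ 𝓤} => g u.1)) ∧
  (((∀ u ∈ 𝓤, g u ≠ ⊥) ∧ ∃ u ∈ 𝓤, g u ≠ ⊤) ∨ ∃ c : EReal, ∀ u ∈ 𝓤, g u = c)

/-- The subdifferential `∂g(u) ⊆ 𝓨` of a function `g` on `𝓤`. -/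
def subdiffFn {Ω : Type} [MeasurableSpace Ω] {m : ℕ} (P : Measure Ω)
    (𝓤 𝓨 : Set (Ω → Fin m → ℝ)) (g : (Ω → Fin m → ℝ) → EReal)
    (u : Ω → Fin m → ℝ) : Set (Ω → Fin m → ℝ) :=
  {y | y ∈ 𝓨 ∧ ∀ u' ∈ 𝓤, g u + ((pairing P (u' - u) y : ℝ) : EReal) ≤ g u'}


lemma aux_capac {X : Type*} [TopologicalSpace X] [MeasurableSpace X]
    (μ : Measure X) [IsFiniteMeasure μ] [μ.OuterRegular]
    (g : (ℕ → ℕ) → X) (hg : Continuous g) (c : ℝ≥0∞) (hc : c < μ (Set.range g)) :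
    ∃ K : Set (ℕ → ℕ), IsCompact K ∧ c ≤ μ (g '' K) := by
  have step : ∀ (k : ℕ) (A : {A : Set (ℕ → ℕ) // c < μ (g '' A)}),
      ∃ N : ℕ, c < μ (g '' (A.1 ∩ {x | x k ≤ N})) := by
    intro k A
    have hU : g '' A.1 = ⋃ N : ℕ, g '' (A.1 ∩ {x | x k ≤ N}) := by
      rw [← Set.image_iUnion]
      congr 1
      ext x
      simp only [Set.mem_iUnion, Set.mem_inter_iff, Set.mem_ofPred_eq]
      exact ⟨fun h => ⟨x k, h, le_rfl⟩, fun ⟨_, h, _⟩ => h⟩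
    have hm : Monotone (fun N : ℕ => g '' (A.1 ∩ {x | x k ≤ N})) := by
      intro a b hab
      refine Set.image_mono (Set.inter_subset_inter_right _ ?_)
      intro x hx
      exact le_trans hx hab
    have h2 := A.2
    rw [hU, hm.measure_iUnion] at h2
    exact lt_iSup_iff.1 h2
  choose N hN using step
  let A : ℕ → {A : Set (ℕ → ℕ) // c < μ (g '' A)} := fun k =>
    Nat.rec ⟨Set.univ, by simpa using hc⟩ (fun k A => ⟨A.1 ∩ {x | x k ≤ N k A}, hN k A⟩) k
  let n : ℕ → ℕ := fun k => N k (A k)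
  have hA : ∀ k, (A k).1 = {x | ∀ i < k, x i ≤ n i} := by
    intro k
    induction k with
    | zero => ext x; simp [A]
    | succ k ih =>
      have : (A (k+1)).1 = (A k).1 ∩ {x | x k ≤ n k} := rfl
      rw [this, ih]
      ext x
      simp only [Set.mem_inter_iff, Set.mem_ofPred_eq, Nat.lt_succ_iff_lt_or_eq]
      constructor
      · rintro ⟨h1, h2⟩ i (hi | rfl)
        · exact h1 i hi
        · exact h2
      · intro h
        exact ⟨fun i hi => h i (Or.inl hi), h k (Or.inr rfl)⟩
  let K : Set (ℕ → ℕ) := Set.univ.pi fun i => Set.Iic (n i)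
  have hK : IsCompact K := isCompact_univ_pi fun i => (Set.finite_Iic (n i)).isCompact
  refine ⟨K, hK, ?_⟩
  rw [Set.measure_eq_iInf_isOpen (g '' K) μ]
  refine le_iInf fun U => le_iInf fun hKU => le_iInf fun hU => ?_
  have key : ∃ k, (A k).1 ⊆ g ⁻¹' U := by
    by_contra! hcon
    simp only [Set.not_subset] at hcon
    choose x hx hxU using hcon
    obtain ⟨z, hz, φ, hφ, hlim⟩ := hK.tendsto_subseq (x := fun k i => min (x k i) (n i))
      (fun k i _ => by simp)
    have hlim2 : Filter.Tendsto (fun k => x (φ k)) Filter.atTop (nhds z) := by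
      rw [tendsto_pi_nhds] at hlim ⊢
      intro i
      refine (hlim i).congr' ?_
      filter_upwards [Filter.eventually_gt_atTop i] with k hk
      have h1 := hx (φ k)
      rw [hA] at h1
      simpa using h1 i (lt_of_lt_of_le hk (hφ.id_le k))
    have hzU : g z ∈ U := hKU ⟨z, hz, rfl⟩
    have := ((hg.tendsto z).comp hlim2).eventually (hU.mem_nhds hzU)
    obtain ⟨k, hk⟩ := this.exists
    exact hxU _ hk
  obtain ⟨k, hk⟩ := key
  exact (A k).2.le.trans (measure_mono (Set.image_subset_iff.2 hk))

lemma aux_analytic {X : Type*} [TopologicalSpace X] [T2Space X] [MeasurableSpace X]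
    [OpensMeasurableSpace X]
    (μ : Measure X) [IsFiniteMeasure μ] [μ.OuterRegular] (s : Set X) (hs : AnalyticSet s) :
    NullMeasurableSet s μ := by
  rw [AnalyticSet] at hs
  rcases hs with rfl | ⟨g, hg, rfl⟩
  · exact nullMeasurableSet_empty
  by_cases h0 : μ (Set.range g) = 0
  · exact NullMeasurableSet.of_null h0
  obtain ⟨c, -, hc, hlim⟩ := exists_seq_strictMono_tendsto' (pos_iff_ne_zero.2 h0)
  choose K hK hcK using fun j => aux_capac μ g hg (c j) (hc j).2
  let C := ⋃ j, g '' (K j)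
  have hCm : MeasurableSet C :=
    MeasurableSet.iUnion fun j => ((hK j).image hg).isClosed.measurableSet
  have hCs : C ⊆ Set.range g := Set.iUnion_subset fun j => Set.image_subset_range _ _
  have hμ : μ (Set.range g) ≤ μ C := by
    refine le_of_tendsto' hlim fun j => (hcK j).trans (measure_mono (Set.subset_iUnion (fun j => g '' (K j)) j))
  have hae : C =ᵐ[μ] Set.range g := by
    have h1 : C =ᵐ[μ] toMeasurable μ (Set.range g) :=
      ae_eq_of_subset_of_measure_ge (hCs.trans (subset_toMeasurable _ _))
        (by rw [measure_toMeasurable]; exact hμ) hCm.nullMeasurableSet (measure_ne_top _ _)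
    refine Filter.EventuallyLE.antisymm (Filter.Eventually.of_forall hCs) ?_
    exact Filter.EventuallyLE.trans
      (Filter.Eventually.of_forall (subset_toMeasurable μ (Set.range g))) h1.symm.le
  exact hCm.nullMeasurableSet.congr hae

lemma aux_code {Z Ω : Type*} [MeasurableSpace Z] [MeasurableSpace Ω] (G : Set (Z × Ω))
    (hG : MeasurableSet G) :
    ∃ (ξ : Ω → ℕ → Bool) (B : Set (Z × (ℕ → Bool))), Measurable ξ ∧ MeasurableSet B ∧
      G = Prod.map id ξ ⁻¹' B := by
  classical
  induction G, hG using MeasurableSpace.induction_on_inter generateFrom_prod.symm isPiSystem_prod with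
  | empty => exact ⟨fun _ _ => true, ∅, measurable_const, MeasurableSet.empty, by simp⟩
  | basic t ht =>
    obtain ⟨a, ha, b, hb, rfl⟩ := ht
    refine ⟨fun ω _ => decide (ω ∈ b), a ×ˢ {w | w 0 = true}, ?_, ?_, ?_⟩
    · refine measurable_pi_lambda _ fun _ => measurable_to_bool ?_
      convert (show MeasurableSet b from hb)
      ext; simp
    · have h0 : Measurable fun w : ℕ → Bool => w 0 := measurable_pi_apply 0
      exact MeasurableSet.prod ha (measurableSet_eq_fun h0 measurable_const)
    · ext ⟨z, ω⟩; simp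
  | compl t ht ih =>
    obtain ⟨ξ, B, h1, h2, rfl⟩ := ih
    exact ⟨ξ, Bᶜ, h1, h2.compl, rfl⟩
  | iUnion t hd ht ih =>
    choose ξ B h1 h2 h3 using ih
    refine ⟨fun ω k => ξ k.unpair.1 ω k.unpair.2,
      ⋃ n, {p | (p.1, fun j => p.2 (Nat.pair n j)) ∈ B n}, ?_, ?_, ?_⟩
    · exact measurable_pi_lambda _ fun k => (measurable_pi_apply _).comp (h1 _)
    · refine MeasurableSet.iUnion fun n => ?_
      have : Measurable fun p : Z × (ℕ → Bool) => (p.1, fun j => p.2 (Nat.pair n j)) := by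
        fun_prop
      exact this (h2 n)
    · ext ⟨z, ω⟩
      simp only [Set.mem_iUnion, Set.mem_preimage, Prod.map, Set.mem_ofPred_eq, Nat.unpair_pair, id]
      refine exists_congr fun n => ?_
      rw [h3 n]; rfl

lemma aux_proj {Z Ω : Type*} [TopologicalSpace Z] [PolishSpace Z] [MeasurableSpace Z] [BorelSpace Z]
    [MeasurableSpace Ω] (P : Measure Ω) [IsFiniteMeasure P] (G : Set (Z × Ω))
    (hG : MeasurableSet G) : NullMeasurableSet {ω | ∃ z, (z, ω) ∈ G} P := by
  have : PolishSpace Bool := inferInstance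
  have : PolishSpace (ℕ → Bool) := inferInstance
  obtain ⟨ξ, B, h1, h2, rfl⟩ := aux_code G hG
  have hB : AnalyticSet (Prod.snd '' B) := h2.analyticSet.image_of_continuous continuous_snd
  have := aux_analytic (P.map ξ) _ hB
  have h3 := this.preimage (h1.measurePreserving P).quasiMeasurePreserving
  convert h3
  ext ω
  simp [Prod.map]
lemma aux_zero {Ω : Type*} [mΩ : MeasurableSpace Ω] (P : Measure Ω) [IsProbabilityMeasure P]
    {ι : Type*} [LinearOrder ι] (ℱ : ι → MeasurableSpace Ω)
    (hle : ∀ t, ℱ t ≤ mΩ) (hmono : Monotone ℱ) (κ : ι → Type*) [∀ t, Fintype (κ t)]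
    (x : ∀ t, κ t → Ω → ℝ) (hx : ∀ t i, Measurable[ℱ t] (x t i)) (s : Finset ι) :
    ∀ (v : ∀ t, κ t → Ω → ℝ), (∀ t ∈ s, ∀ i, Integrable (v t i) P) →
      (∀ t ∈ s, ∀ i, P[v t i | ℱ t] =ᵐ[P] 0) →
      ∀ k : Ω → ℝ, Integrable k P →
      (∀ᵐ ω ∂P, ∑ t ∈ s, ∑ i, x t i ω * v t i ω ≤ k ω) →
      Integrable (fun ω => ∑ t ∈ s, ∑ i, x t i ω * v t i ω) P ∧
        ∫ ω, ∑ t ∈ s, ∑ i, x t i ω * v t i ω ∂P = 0 := by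
  induction s using Finset.induction_on_max with
  | empty => intro v _ _ k _ _; simp
  | insert a s has ih =>
  intro v hv hv0 k hk hSk
  have hans : a ∉ s := fun h => lt_irrefl _ (has a h)
  set S : Ω → ℝ := fun ω => ∑ t ∈ insert a s, ∑ i, x t i ω * v t i ω with hS
  let v' : ∀ t, κ t → Ω → ℝ := fun t i => P[v t i | ℱ a]
  set S' : Ω → ℝ := fun ω => ∑ t ∈ s, ∑ i, x t i ω * v' t i ω with hS'
  let A : ℕ → Set Ω := fun n => {ω | ∀ t ∈ insert a s, ∀ i, |x t i ω| ≤ n}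
  have hta : ∀ t ∈ insert a s, t ≤ a := by
    intro t ht
    rcases Finset.mem_insert.1 ht with rfl | h
    · exact le_rfl
    · exact (has t h).le
  have hxa : ∀ t ∈ insert a s, ∀ i, Measurable[ℱ a] (x t i) := fun t ht i =>
    (hx t i).mono (hmono (hta t ht)) le_rfl
  have hA : ∀ n, MeasurableSet[ℱ a] (A n) := by
    intro n
    have : A n = ⋂ t ∈ insert a s, ⋂ i, {ω | |x t i ω| ≤ n} := by
      ext ω; simp [A]
    rw [this]
    refine Finset.measurableSet_biInter _ fun t ht => MeasurableSet.iInter fun i => ?_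
    exact measurableSet_le (measurable_abs.comp (hxa t ht i)) measurable_const
  have hAm : ∀ n, MeasurableSet (A n) := fun n => hle a _ (hA n)
  have hAev : ∀ ω, ∀ᶠ n in Filter.atTop, ω ∈ A n := by
    intro ω
    simp only [A, Set.mem_ofPred_eq, Filter.eventually_all, Filter.eventually_all_finset]
    intro t _ i
    exact tendsto_natCast_atTop_atTop.eventually_ge_atTop _
  have hAlim : ∀ (g : Ω → ℝ) ω,
      Filter.Tendsto (fun n => (A n).indicator g ω) Filter.atTop (nhds (g ω)) := by
    intro g ω
    refine tendsto_const_nhds.congr' ?_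
    filter_upwards [hAev ω] with n hn
    rw [Set.indicator_of_mem hn]
  -- truncated coefficients
  have hcm : ∀ n, ∀ t ∈ insert a s, ∀ i, StronglyMeasurable[ℱ a] ((A n).indicator (x t i)) :=
    fun n t ht i => ((hxa t ht i).indicator (hA n)).stronglyMeasurable
  have hcb : ∀ n, ∀ t ∈ insert a s, ∀ i, ∀ ω, ‖(A n).indicator (x t i) ω‖ ≤ n := by
    intro n t ht i ω
    by_cases h : ω ∈ A n
    · rw [Set.indicator_of_mem h]; exact h t ht i
    · rw [Set.indicator_of_notMem h]; simp
  have hint : ∀ n, ∀ t ∈ insert a s, ∀ i, Integrable ((A n).indicator (x t i) * v t i) P := by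
    intro n t ht i
    exact (hv t ht i).bdd_mul (c := n) ((hcm n t ht i).mono (hle a)).aestronglyMeasurable
      (Filter.Eventually.of_forall (hcb n t ht i))
  have hSA : ∀ n, (A n).indicator S
      = ∑ t ∈ insert a s, ∑ i, (A n).indicator (x t i) * v t i := by
    intro n
    ext ω
    by_cases h : ω ∈ A n <;> simp [h, hS, Finset.sum_apply]
  have hSAint : ∀ n, Integrable ((A n).indicator S) P := by
    intro n
    rw [hSA]
    exact integrable_finsetSum' _ fun t ht => integrable_finsetSum' _ fun i _ => hint n t ht i
  have hcond : ∀ n, P[(A n).indicator S | ℱ a] =ᵐ[P] (A n).indicator S' := by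
    intro n
    rw [hSA]
    have e1 := condExp_finsetSum (m := ℱ a) (μ := P) (s := insert a s)
      (f := fun t => ∑ i, (A n).indicator (x t i) * v t i)
      (fun t ht => integrable_finsetSum' _ fun i _ => hint n t ht i)
    have e2 : ∀ t ∈ insert a s, P[∑ i, (A n).indicator (x t i) * v t i | ℱ a]
        =ᵐ[P] ∑ i, (A n).indicator (x t i) * v' t i := by
      intro t ht
      refine (condExp_finsetSum (m := ℱ a) (fun i _ => hint n t ht i)).trans ?_
      have : ∀ i, P[(A n).indicator (x t i) * v t i | ℱ a]
          =ᵐ[P] (A n).indicator (x t i) * v' t i := fun i =>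
        condExp_mul_of_stronglyMeasurable_left (hcm n t ht i) (hint n t ht i) (hv t ht i)
      filter_upwards [ae_all_iff.2 this] with ω hω
      simp only [Finset.sum_apply]
      exact Finset.sum_congr rfl fun i _ => hω i
    have e3 : ∀ᵐ ω ∂P, ∀ i, v' a i ω = 0 :=
      ae_all_iff.2 fun i => hv0 a (Finset.mem_insert_self a s) i
    have e4 : ∀ᵐ ω ∂P, ∀ t ∈ insert a s, P[∑ i, (A n).indicator (x t i) * v t i | ℱ a] ω
        = (∑ i, (A n).indicator (x t i) * v' t i) ω := by
      rw [Filter.eventually_all_finset]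
      exact e2
    filter_upwards [e1, e3, e4] with ω h1 h3 h4
    rw [h1, Finset.sum_apply, Finset.sum_congr rfl h4, Finset.sum_insert hans]
    by_cases h : ω ∈ A n <;> simp [h, hS', Finset.sum_apply, h3]
  have hkabs : Integrable (fun ω => |k ω|) P := hk.abs
  have hS'k : ∀ᵐ ω ∂P, S' ω ≤ P[fun ω => |k ω| | ℱ a] ω := by
    have h1 : ∀ n, ∀ᵐ ω ∂P, (A n).indicator S' ω ≤ P[fun ω => |k ω| | ℱ a] ω := by
      intro n
      have : (A n).indicator S ≤ᵐ[P] fun ω => |k ω| := by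
        filter_upwards [hSk] with ω hω
        by_cases h : ω ∈ A n
        · rw [Set.indicator_of_mem h]; exact hω.trans (le_abs_self _)
        · rw [Set.indicator_of_notMem h]; exact abs_nonneg _
      filter_upwards [hcond n, condExp_mono (m := ℱ a) (hSAint n) hkabs this] with ω h1 h2
      rw [← h1]; exact h2
    filter_upwards [ae_all_iff.2 h1] with ω hω
    exact le_of_tendsto' (hAlim S' ω) hω
  obtain ⟨hS'int, hS'0⟩ := ih v' (fun t _ i => integrable_condExp)
    (fun t ht i => by
      refine (condExp_condExp_of_le (hmono (has t ht).le) (hle a)).trans ?_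
      exact hv0 t (Finset.mem_insert_of_mem ht) i)
    _ integrable_condExp hS'k
  have hSAeq : ∀ n, ∫ ω, (A n).indicator S ω ∂P = ∫ ω, (A n).indicator S' ω ∂P := by
    intro n
    rw [← integral_condExp (hle a)]
    exact integral_congr_ae (hcond n)
  have hdom : ∀ g : Ω → ℝ, Integrable g P → Filter.Tendsto
      (fun n => ∫ ω, (A n).indicator g ω ∂P) Filter.atTop (nhds (∫ ω, g ω ∂P)) := by
    intro g hg
    refine tendsto_integral_of_dominated_convergence (fun ω => ‖g ω‖)
      (fun n => (hg.indicator (hAm n)).aestronglyMeasurable) hg.norm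
      (fun n => Filter.Eventually.of_forall fun ω => norm_indicator_le_norm_self g ω)
      (Filter.Eventually.of_forall (hAlim g))
  have hlim0 : Filter.Tendsto (fun n => ∫ ω, (A n).indicator S ω ∂P) Filter.atTop (nhds 0) := by
    simp only [hSAeq]
    have := hdom S' hS'int
    rwa [hS'0] at this
  have hSm : AEStronglyMeasurable S P := by
    refine aestronglyMeasurable_of_tendsto_ae Filter.atTop
      (fun n => (hSAint n).aestronglyMeasurable) (Filter.Eventually.of_forall (hAlim S))
  have hSint : Integrable S P := by
    have hD : Integrable (fun ω => k ω - S ω) P := by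
      let D : Ω → ℝ := fun ω => k ω - S ω
      have hDA : ∀ n, (A n).indicator D = (A n).indicator k - (A n).indicator S := by
        intro n
        ext ω
        by_cases h : ω ∈ A n <;> simp [h, D]
      have hDint : ∀ n, Integrable ((A n).indicator D) P := by
        intro n
        rw [hDA]
        exact (hk.indicator (hAm n)).sub (hSAint n)
      have hDnn : ∀ n, 0 ≤ᵐ[P] (A n).indicator D := by
        intro n
        filter_upwards [hSk] with ω hω
        have hD0 : 0 ≤ D ω := sub_nonneg.2 hω
        by_cases h : ω ∈ A n <;> simp [h, hD0]
      have hDl : ∀ n, ∫⁻ ω, ‖(A n).indicator D ω‖ₑ ∂P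
          = ENNReal.ofReal (∫ ω, (A n).indicator k ω ∂P - ∫ ω, (A n).indicator S ω ∂P) := by
        intro n
        rw [← integral_sub (hk.indicator (hAm n)) (hSAint n),
          ofReal_integral_eq_lintegral_ofReal]
        · refine lintegral_congr_ae ?_
          filter_upwards [hDnn n] with ω hω
          rw [Real.enorm_eq_ofReal hω, hDA]
          rfl
        · exact (hk.indicator (hAm n)).sub (hSAint n)
        · have := hDnn n
          rw [hDA] at this
          exact this
      have hDlim : Filter.Tendsto (fun n => ∫⁻ ω, ‖(A n).indicator D ω‖ₑ ∂P) Filter.atTop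
          (nhds (ENNReal.ofReal (∫ ω, k ω ∂P - 0))) := by
        simp only [hDl]
        exact (ENNReal.continuous_ofReal.tendsto _).comp ((hdom k hk).sub hlim0)
      refine ⟨hk.aestronglyMeasurable.sub hSm, ?_⟩
      have hF : ∫⁻ ω, ‖D ω‖ₑ ∂P ≤
          Filter.liminf (fun n => ∫⁻ ω, ‖(A n).indicator D ω‖ₑ ∂P) Filter.atTop := by
        have h1 : ∀ ω, ‖D ω‖ₑ = Filter.liminf (fun n => ‖(A n).indicator D ω‖ₑ) Filter.atTop :=
          fun ω => ((hAlim D ω).enorm).liminf_eq.symm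
        simp only [h1]
        exact lintegral_liminf_le' fun n => (hDint n).aestronglyMeasurable.enorm
      rw [hDlim.liminf_eq] at hF
      exact hF.trans_lt ENNReal.ofReal_lt_top
    have := hk.sub hD
    refine this.congr (Filter.Eventually.of_forall fun ω => ?_)
    simp
  refine ⟨hSint, tendsto_nhds_unique (hdom S hSint) hlim0⟩

lemma epos_eq (a : EReal) : epos a = a.toENNReal := rfl

lemma aux_EE {Ω : Type} [MeasurableSpace Ω] (P : Measure Ω) (φ : Ω → EReal)
    (hφ : AEMeasurable φ P) (h1 : EE P φ ≠ ⊤) (h2 : EE P φ ≠ ⊥) :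
    Integrable (fun ω => (φ ω).toReal) P ∧ (∀ᵐ ω ∂P, φ ω = (((φ ω).toReal : ℝ) : EReal)) ∧
      EE P φ = ((∫ ω, (φ ω).toReal ∂P : ℝ) : EReal) := by
  have hm1 : AEMeasurable (fun ω => epos (φ ω)) P := by
    simp only [epos_eq]
    exact hφ.ereal_toENNReal
  have hm2 : AEMeasurable (fun ω => epos (-φ ω)) P := by
    simp only [epos_eq]
    exact (measurable_ereal_toENNReal.comp measurable_neg).comp_aemeasurable hφ
  unfold EE at h1 h2 ⊢
  by_cases hp : ∫⁻ ω, epos (φ ω) ∂P = ⊤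
  · simp [hp] at h1
  rw [if_neg hp] at h1 h2 ⊢
  have hn : ∫⁻ ω, epos (-φ ω) ∂P ≠ ⊤ := by
    intro hn
    rw [hn] at h2
    simp at h2
  have hpa := ae_lt_top' hm1 hp
  have hna := ae_lt_top' hm2 hn
  have hfin : ∀ᵐ ω ∂P, φ ω = (((φ ω).toReal : ℝ) : EReal) := by
    filter_upwards [hpa, hna] with ω ha hb
    refine (EReal.coe_toReal ?_ ?_).symm
    · intro h; simp [h, epos] at ha
    · intro h; simp [h, epos] at hb
  have e1 : ∫⁻ ω, epos (φ ω) ∂P = ∫⁻ ω, ENNReal.ofReal (φ ω).toReal ∂P := by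
    refine lintegral_congr_ae ?_
    filter_upwards [hfin] with ω hω
    have : φ ω ≠ ⊤ := by rw [hω]; exact EReal.coe_ne_top _
    simp [epos, this]
  have e2 : ∫⁻ ω, epos (-φ ω) ∂P = ∫⁻ ω, ENNReal.ofReal (-(φ ω).toReal) ∂P := by
    refine lintegral_congr_ae ?_
    filter_upwards [hfin] with ω hω
    have : φ ω ≠ ⊥ := by rw [hω]; exact EReal.coe_ne_bot _
    simp [epos, this]
  have hint : Integrable (fun ω => (φ ω).toReal) P := by
    refine ⟨hφ.ereal_toReal.aestronglyMeasurable, ?_⟩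
    have : ∀ r : ℝ, ‖r‖ₑ ≤ ENNReal.ofReal r + ENNReal.ofReal (-r) := by
      intro r
      rw [← ofReal_norm, Real.norm_eq_abs]
      rcases le_total 0 r with h | h
      · rw [abs_of_nonneg h]; exact le_self_add
      · rw [abs_of_nonpos h]; exact le_add_self
    refine (lintegral_mono (fun ω => this _)).trans_lt ?_
    rw [lintegral_add_left' hφ.ereal_toReal.ennreal_ofReal, ← e1, ← e2]
    exact ENNReal.add_lt_top.2 ⟨Ne.lt_top hp, Ne.lt_top hn⟩
  refine ⟨hint, hfin, ?_⟩
  rw [integral_eq_lintegral_pos_part_sub_lintegral_neg_part hint, ← e1, ← e2, EReal.coe_sub,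
    EReal.coe_ennreal_toReal hp, EReal.coe_ennreal_toReal hn]

lemma aux_fconj {Ω : Type} [MeasurableSpace Ω] (P : Measure Ω) [IsProbabilityMeasure P]
    {T : ℕ} (nt : Fin (T+1) → ℕ) {m : ℕ}
    (f : Vec nt → (Fin m → ℝ) → Ω → EReal)
    (hf_meas : Measurable (fun p : (Vec nt × (Fin m → ℝ)) × Ω => f p.1.1 p.1.2 p.2))
    (v : Ω → Vec nt) (y : Ω → Fin m → ℝ) (hv : Measurable v) (hy : Measurable y) :
    AEMeasurable (fun ω => fconj f (v ω) (y ω) ω) P := by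
  refine NullMeasurable.aemeasurable ?_
  have : @Measurable (NullMeasurableSpace Ω P) EReal _ _ (fun ω => fconj f (v ω) (y ω) ω) := by
    refine measurable_of_Ioi fun c => ?_
    have hG : MeasurableSet {p : (Vec nt × (Fin m → ℝ)) × Ω |
        c < (((dotN nt p.1.1 (v p.2) + dotM p.1.2 (y p.2) : ℝ) : EReal) - f p.1.1 p.1.2 p.2)} := by
      refine measurableSet_lt measurable_const ?_
      simp only [sub_eq_add_neg]
      refine Measurable.add (Measurable.coe_real_ereal ?_) (measurable_neg.comp hf_meas)
      unfold dotN dotM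
      fun_prop
    have := aux_proj P _ hG
    have h2 : NullMeasurableSet ((fun ω => fconj f (v ω) (y ω) ω) ⁻¹' Set.Ioi c) P := by
      convert this using 1
      ext ω
      simp [fconj, lt_iSup_iff]
    exact h2
  exact fun s hs => this hs

lemma aux_perp {Ω : Type} [mΩ : MeasurableSpace Ω] (P : Measure Ω) [IsProbabilityMeasure P]
    {T : ℕ} (ℱ : Fin (T+1) → MeasurableSpace Ω)
    (hle : ∀ t, ℱ t ≤ mΩ) (hmono : Monotone ℱ) (nt : Fin (T+1) → ℕ)
    (x : Ω → Vec nt) (hx : x ∈ Nspace nt ℱ) (v : Ω → Vec nt) (hv : v ∈ Nperp nt ℱ P)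
    (k : Ω → ℝ) (hk : Integrable k P) (hxk : ∀ᵐ ω ∂P, dotN nt (x ω) (v ω) ≤ k ω) :
    Integrable (fun ω => dotN nt (x ω) (v ω)) P ∧ ∫ ω, dotN nt (x ω) (v ω) ∂P = 0 := by
  classical
  obtain ⟨hvm, hvi, hv0⟩ := hv
  have hvti : ∀ t i, Integrable (fun ω => v ω t i) P := by
    intro t i
    refine hvi.mono ?_ (Filter.Eventually.of_forall fun ω => ?_)
    · exact Measurable.aestronglyMeasurable (by fun_prop)
    · exact (norm_le_pi_norm (v ω t) i).trans (norm_le_pi_norm (v ω) t)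
  refine aux_zero P ℱ hle hmono (fun t => Fin (nt t)) (fun t i ω => x ω t i) ?_ Finset.univ
    (fun t i ω => v ω t i) (fun t _ i => hvti t i) ?_ k hk hxk
  · intro t i
    exact (measurable_pi_apply i).comp (hx t)
  · intro t _ i
    symm
    refine ae_eq_condExp_of_forall_setIntegral_eq (hle t) (hvti t i) ?_ ?_ ?_
    · intro s _ _
      exact integrableOn_zero
    · intro s hs _
      have hs' : MeasurableSet s := hle t s hs
      let z : Ω → Vec nt := fun ω t' i' => if t' = t ∧ (i' : ℕ) = i then s.indicator 1 ω else 0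
      have hz : z ∈ NspaceInf nt ℱ P := by
        refine ⟨?_, 1, Filter.Eventually.of_forall fun ω => ?_⟩
        · intro t'
          refine @measurable_pi_lambda _ _ _ (ℱ t') _ _ (fun i' => ?_)
          by_cases h : t' = t ∧ (i' : ℕ) = i
          · obtain ⟨rfl, h2⟩ := h
            simp only [z, h2, and_self, if_true]
            exact Measurable.indicator (m := ℱ t') (@measurable_const _ _ _ (ℱ t') (1 : ℝ)) hs
          · simp only [z, h, if_false]
            exact @measurable_const _ _ _ (ℱ t') _
        · refine (pi_norm_le_iff_of_nonneg zero_le_one).2 fun t' =>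
            (pi_norm_le_iff_of_nonneg zero_le_one).2 fun i' => ?_
          by_cases h : t' = t ∧ (i' : ℕ) = i <;> by_cases h2 : ω ∈ s <;> simp [z, h, h2]
      have h0 := hv0 z hz
      have hd : ∀ ω, dotN nt (z ω) (v ω) = s.indicator (fun ω => v ω t i) ω := by
        intro ω
        unfold dotN
        rw [Finset.sum_eq_single t, Finset.sum_eq_single i]
        · by_cases h2 : ω ∈ s <;> simp [z, h2]
        · intro b _ hb
          have : (b : ℕ) ≠ i := fun h => hb (Fin.ext h)
          simp [z, this]
        · simp
        · intro b _ hb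
          simp [z, hb]
        · simp
      simp only [hd] at h0
      rw [integral_indicator hs'] at h0
      rw [h0]
      simp
    · exact stronglyMeasurable_zero.aestronglyMeasurable

/-- optimality conditions in terms of the subdifferential of `f`. -/
theorem stmt_11
    {Ω : Type} [mΩ : MeasurableSpace Ω] (P : Measure Ω) [IsProbabilityMeasure P]
    {T : ℕ} (ℱ : Fin (T+1) → MeasurableSpace Ω)
    (hℱ_le : ∀ t, ℱ t ≤ mΩ) (hℱ_mono : Monotone ℱ)
    (nt : Fin (T+1) → ℕ) {m : ℕ}
    -- `f` is a convex normal integrand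
    (f : Vec nt → (Fin m → ℝ) → Ω → EReal)
    (hf_meas : Measurable (fun p : (Vec nt × (Fin m → ℝ)) × Ω => f p.1.1 p.1.2 p.2))
    (hf_proper : ∀ ω, (∀ x u, f x u ω ≠ ⊥) ∧ ∃ x u, f x u ω ≠ ⊤)
    (hf_lsc : ∀ ω, LowerSemicontinuous (fun p : Vec nt × (Fin m → ℝ) => f p.1 p.2 ω))
    (hf_convex : ∀ (ω : Ω) (a b : ℝ) (x₁ x₂ : Vec nt) (u₁ u₂ : Fin m → ℝ),
      0 < a → 0 < b → a + b = 1 →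
      f (a • x₁ + b • x₂) (a • u₁ + b • u₂) ω ≤
        (a : EReal) * f x₁ u₁ ω + (b : EReal) * f x₂ u₂ ω)
    -- `𝓤` and `𝓨` are decomposable subspaces of `L⁰` in separating duality
    (𝓤 𝓨 : Set (Ω → Fin m → ℝ))
    (h𝓤meas : ∀ u ∈ 𝓤, Measurable u) (h𝓨meas : ∀ y ∈ 𝓨, Measurable y)
    (h𝓤sub : ∀ u ∈ 𝓤, ∀ u' ∈ 𝓤, ∀ c : ℝ, u + u' ∈ 𝓤 ∧ c • u ∈ 𝓤)
    (h𝓨sub : ∀ y ∈ 𝓨, ∀ y' ∈ 𝓨, ∀ c : ℝ, y + y' ∈ 𝓨 ∧ c • y ∈ 𝓨)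
    (h𝓤dec : Decomposable P 𝓤) (h𝓨dec : Decomposable P 𝓨)
    (hpair : ∀ u ∈ 𝓤, ∀ y ∈ 𝓨, Integrable (fun ω => dotM (u ω) (y ω)) P)
    (hsep𝓤 : ∀ u ∈ 𝓤, (∀ y ∈ 𝓨, pairing P u y = 0) → u =ᵐ[P] (fun _ => 0))
    (hsep𝓨 : ∀ y ∈ 𝓨, (∀ u ∈ 𝓤, pairing P u y = 0) → y =ᵐ[P] (fun _ => 0))
    (u : Ω → Fin m → ℝ) (hu : u ∈ 𝓤)
    -- `u ↦ Ef(x,u)` is closed for every `x ∈ 𝓝`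
    (hclosed : ∀ x ∈ Nspace nt ℱ, ClosedFn P 𝓤 𝓨 (fun u' => intF P f x u'))
    -- `φ` is proper
    (hproper : (∀ u' ∈ 𝓤, valueFn P f ℱ u' ≠ ⊥) ∧ ∃ u' ∈ 𝓤, valueFn P f ℱ u' ≠ ⊤)
    -- `∂φ(u) ≠ ∅`
    (hsubne : (subdiffFn P 𝓤 𝓨 (valueFn P f ℱ) u).Nonempty)
    -- every `y ∈ ∂φ(u)` admits `v ∈ 𝓝^⊥` with `φ*(y) = Ef*(v,y)`
    (hrep : ∀ y ∈ subdiffFn P 𝓤 𝓨 (valueFn P f ℱ) u,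
      ∃ v ∈ Nperp nt ℱ P, conj P 𝓤 (valueFn P f ℱ) y = intFconj P f v y) :
    ∀ x ∈ Nspace nt ℱ,
      (intF P f x u = valueFn P f ℱ u ↔
        (intF P f x u < ⊤ ∧
          ∃ y ∈ 𝓨, ∃ v ∈ Nperp nt ℱ P, ∀ᵐ ω ∂P,
            ∀ (x' : Vec nt) (u' : Fin m → ℝ),
              f (x ω) (u ω) ω +
                ((dotN nt (v ω) (x' - x ω) + dotM (y ω) (u' - u ω) : ℝ) : EReal) ≤
                f x' u' ω)) := by
  intro x hx
  have hxm : Measurable x := measurable_pi_lambda _ fun t => (hx t).mono (hℱ_le t) le_rfl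
  have hum : Measurable u := h𝓤meas u hu
  have hfm : ∀ z : Ω → Vec nt, Measurable z → AEMeasurable (fun ω => f (z ω) (u ω) ω) P := by
    intro z hz
    exact (hf_meas.comp ((hz.prodMk hum).prodMk measurable_id)).aemeasurable
  have hbot : ∀ z ∈ Nspace nt ℱ, intF P f z u ≠ ⊥ := by
    intro z hz h
    refine hproper.1 u hu (le_bot_iff.1 ?_)
    rw [← h]
    exact iInf₂_le z hz
  have dotM_comm : ∀ a b : Fin m → ℝ, dotM a b = dotM b a := fun a b => by
    unfold dotM; exact Finset.sum_congr rfl fun _ _ => mul_comm _ _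
  have dotM_sub : ∀ a b c : Fin m → ℝ, dotM a (b - c) = dotM a b - dotM a c := fun a b c => by
    simp [dotM, mul_sub]
  have dotN_comm : ∀ a b : Vec nt, dotN nt a b = dotN nt b a := fun a b => by
    unfold dotN
    exact Finset.sum_congr rfl fun _ _ => Finset.sum_congr rfl fun _ _ => mul_comm _ _
  have dotN_sub : ∀ a b c : Vec nt, dotN nt a (b - c) = dotN nt a b - dotN nt a c :=
    fun a b c => by simp [dotN, mul_sub]
  constructor
  · intro hsol
    obtain ⟨y, hy⟩ := hsubne
    obtain ⟨v, hv, hconj⟩ := hrep y hy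
    have hym : Measurable y := h𝓨meas y hy.1
    have htop : valueFn P f ℱ u ≠ ⊤ := by
      obtain ⟨u', hu', hne⟩ := hproper.2
      intro h
      have h1 := hy.2 u' hu'
      rw [h, EReal.top_add_coe] at h1
      exact hne (top_le_iff.1 h1)
    have hbotv := hproper.1 u hu
    have hftop : intF P f x u ≠ ⊤ := by rw [hsol]; exact htop
    refine ⟨Ne.lt_top hftop, y, hy.1, v, hv, ?_⟩
    obtain ⟨hg, hgfin, hgE⟩ := aux_EE P _ (hfm x hxm) hftop (hbot x hx)
    set g : Ω → ℝ := fun ω => (f (x ω) (u ω) ω).toReal with hgdef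
    have hval : valueFn P f ℱ u = ((∫ ω, g ω ∂P : ℝ) : EReal) := by rw [← hsol]; exact hgE
    have huy := hpair u hu y hy.1
    have hconj2 : conj P 𝓤 (valueFn P f ℱ) y = ((pairing P u y - ∫ ω, g ω ∂P : ℝ) : EReal) := by
      apply le_antisymm
      · refine iSup₂_le fun u' hu' => ?_
        have h1 := hy.2 u' hu'
        have h2 : pairing P (u' - u) y = pairing P u' y - pairing P u y := by
          unfold pairing
          rw [← integral_sub (hpair u' hu' y hy.1) huy]
          refine integral_congr_ae (Filter.Eventually.of_forall fun ω => ?_)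
          simp only [Pi.sub_apply]
          rw [dotM_comm, dotM_sub, dotM_comm, dotM_comm (y ω)]
        rw [hval, h2, ← EReal.coe_add] at h1
        refine (EReal.sub_le_sub le_rfl h1).trans ?_
        rw [← EReal.coe_sub]
        refine EReal.coe_le_coe_iff.2 (le_of_eq ?_)
        ring
      · have h1 : ((pairing P u y - ∫ ω, g ω ∂P : ℝ) : EReal)
            = ((pairing P u y : ℝ) : EReal) - valueFn P f ℱ u := by
          rw [hval, EReal.coe_sub]
        rw [h1]
        exact le_iSup₂ (f := fun u (_ : u ∈ 𝓤) =>
          ((pairing P u y : ℝ) : EReal) - valueFn P f ℱ u) u hu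
    rw [hconj2] at hconj
    obtain ⟨hh, hhfin, hhE⟩ := aux_EE P _ (aux_fconj P nt f hf_meas v y hv.1 hym)
      (by change intFconj P f v y ≠ ⊤; rw [← hconj]; exact EReal.coe_ne_top _)
      (by change intFconj P f v y ≠ ⊥; rw [← hconj]; exact EReal.coe_ne_bot _)
    set h : Ω → ℝ := fun ω => (fconj f (v ω) (y ω) ω).toReal with hhdef
    have hEh : pairing P u y - ∫ ω, g ω ∂P = ∫ ω, h ω ∂P :=
      EReal.coe_injective (hconj.trans hhE)
    have hFY : ∀ ω (x' : Vec nt) (u' : Fin m → ℝ),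
        (((dotN nt x' (v ω) + dotM u' (y ω) : ℝ) : EReal) - f x' u' ω)
          ≤ fconj f (v ω) (y ω) ω := fun ω x' u' =>
      le_iSup₂ (f := fun (x' : Vec nt) (u' : Fin m → ℝ) =>
        (((dotN nt x' (v ω) + dotM u' (y ω) : ℝ) : EReal) - f x' u' ω)) x' u'
    have hxy : ∀ᵐ ω ∂P, dotN nt (x ω) (v ω) ≤ g ω + h ω - dotM (u ω) (y ω) := by
      filter_upwards [hgfin, hhfin] with ω h1 h2
      have h3 := hFY ω (x ω) (u ω)
      rw [h1, h2, ← EReal.coe_sub, EReal.coe_le_coe_iff] at h3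
      change _ - g ω ≤ h ω at h3
      linarith
    obtain ⟨hxv, hxv0⟩ := aux_perp P ℱ hℱ_le hℱ_mono nt x hx v hv _ ((hg.add hh).sub huy) hxy
    have hzero : (fun ω => g ω + h ω - dotM (u ω) (y ω) - dotN nt (x ω) (v ω)) =ᵐ[P] 0 := by
      refine (integral_eq_zero_iff_of_nonneg_ae ?_ (((hg.add hh).sub huy).sub hxv)).1 ?_
      · filter_upwards [hxy] with ω hω
        exact sub_nonneg.2 hω
      · have e1 := integral_sub ((hg.add hh).sub huy) hxv
        have e2 := integral_sub (hg.add hh) huy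
        have e3 := integral_add hg hh
        simp only [Pi.add_apply, Pi.sub_apply] at e1 e2 e3
        simp only [Pi.add_apply, Pi.sub_apply]
        rw [e1, e2, e3, hxv0, ← hEh]
        unfold pairing
        ring
    filter_upwards [hgfin, hhfin, hzero] with ω h1 h2 h3 x' u'
    have h4 := hFY ω x' u'
    rw [h2] at h4
    change _ ≤ ((h ω : ℝ) : EReal) at h4
    rw [h1]
    change ((g ω : ℝ) : EReal) + _ ≤ _
    have h5 : g ω + h ω - dotM (u ω) (y ω) - dotN nt (x ω) (v ω) = 0 := h3
    rw [dotN_sub, dotM_sub, dotN_comm (v ω) x', dotN_comm (v ω) (x ω), dotM_comm (y ω) u',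
      dotM_comm (y ω) (u ω), ← EReal.coe_add]
    rcases eq_or_ne (f x' u' ω) ⊤ with ht | ht
    · rw [ht]; exact le_top
    · obtain ⟨r, hr⟩ : ∃ r : ℝ, f x' u' ω = (r : EReal) :=
        ⟨_, (EReal.coe_toReal ht ((hf_proper ω).1 x' u')).symm⟩
      rw [hr, ← EReal.coe_sub, EReal.coe_le_coe_iff] at h4
      rw [hr, EReal.coe_le_coe_iff]
      linarith
  · rintro ⟨hfeas, y, hy, v, hv, hsub⟩
    refine le_antisymm (le_iInf₂ fun z hz => ?_) (iInf₂_le x hx)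
    rcases eq_or_ne (intF P f z u) ⊤ with hzt | hzt
    · rw [hzt]; exact le_top
    have hzm : Measurable z := measurable_pi_lambda _ fun t => (hz t).mono (hℱ_le t) le_rfl
    obtain ⟨hg, hgfin, hgE⟩ := aux_EE P _ (hfm x hxm) hfeas.ne (hbot x hx)
    obtain ⟨hh, hhfin, hhE⟩ := aux_EE P _ (hfm z hzm) hzt (hbot z hz)
    set g : Ω → ℝ := fun ω => (f (x ω) (u ω) ω).toReal with hgdef
    set h : Ω → ℝ := fun ω => (f (z ω) (u ω) ω).toReal with hhdef
    have hzx : z - x ∈ Nspace nt ℱ := fun t => (hz t).sub (hx t)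
    have hle : ∀ᵐ ω ∂P, dotN nt ((z - x) ω) (v ω) ≤ h ω - g ω := by
      filter_upwards [hgfin, hhfin, hsub] with ω h1 h2 h3
      have h4 := h3 (z ω) (u ω)
      rw [h1, h2, ← EReal.coe_add, EReal.coe_le_coe_iff, dotM_sub, sub_self, add_zero] at h4
      change g ω + _ ≤ h ω at h4
      rw [Pi.sub_apply, dotN_comm]
      linarith
    obtain ⟨hi, h0⟩ := aux_perp P ℱ hℱ_le hℱ_mono nt (z - x) hzx v hv _ (hh.sub hg) hle
    have h5 := integral_mono_ae hi (hh.sub hg) hle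
    have e1 := integral_sub hh hg
    simp only [Pi.sub_apply] at h5 e1 h0
    rw [h0, e1] at h5
    change EE P _ ≤ EE P _
    rw [hgE, hhE, EReal.coe_le_coe_iff]
    linarith
end

section
/- In the constrained setting, assume that for every x ∈ 𝓝^∞ and j = 0,…,m the function ω ↦ f_j(x(ω),ω) is finite a.s. and belongs to 𝓤₀, that u ↦ Ef(x,u) is closed for every x ∈ 𝓝, that φ is proper, and that ∂φ(u) ≠ ∅ for the given u ∈ 𝓤. Then x ∈ 𝓝 solves (P_u) if and only if Ef(x,u) < +∞ and there exist y ∈ 𝓨 and v ∈ 𝓝^⊥ such that P-almost surely: f_j(x) + u_j ≤ 0 for j = 1,…,m; y_j ≥ 0 for j = 1,…,m; y_j(f_j(x) + u_j) = 0 for j = 1,…,m; and x(ω) ∈ argmin_{z∈ℝ^n}{f_0(z,ω) + Σ_{j=1}^m y_j(ω) f_j(z,ω) − z·v(ω)}. -/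
open MeasureTheory
open scoped ENNReal

open scoped Classical in
/-- The integrand of the constrained problem: `f(x,u,ω) = f₀(x,ω)` if
`f_j(x,ω) + u_j ≤ 0` for all `j = 1,…,m`, and `+∞` otherwise. -/
noncomputable def fCon {Ω : Type} {T : ℕ} {nt : Fin (T+1) → ℕ} {m : ℕ}
    (f0 : Vec nt → Ω → EReal) (fj : Fin m → Vec nt → Ω → EReal) :
    Vec nt → (Fin m → ℝ) → Ω → EReal :=
  fun x u ω => if ∀ j, fj j x ω + ((u j : ℝ) : EReal) ≤ 0 then f0 x ω else ⊤

/-- Decomposability of a set of real-valued measurable functions. -/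
def DecomposableR {Ω : Type} [MeasurableSpace Ω] (P : Measure Ω)
    (S : Set (Ω → ℝ)) : Prop :=
  ∀ A : Set Ω, MeasurableSet A → ∀ u ∈ S, ∀ u' : Ω → ℝ,
    Measurable u' → (∃ M : ℝ, ∀ᵐ ω ∂P, |u' ω| ≤ M) →
    (fun ω => A.indicator u ω + Aᶜ.indicator u' ω) ∈ S

open MeasureTheory
open scoped ENNReal

theorem hb_lemma {E : Type*} [AddCommGroup E] [Module ℝ E] (I : E → ℝ)
    (hI : ConvexOn ℝ Set.univ I) (S : Submodule ℝ E) (c : ℝ) (hc : ∀ s ∈ S, c ≤ I s) :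
    ∃ h : E →ₗ[ℝ] ℝ, (∀ s ∈ S, h s = 0) ∧ ∀ z, h z ≤ I z - c := by
  let A : E → Set ℝ := fun z => {r | ∃ t : ℝ, 0 < t ∧ ∃ s ∈ S, r = t * (I (t⁻¹ • z + s) - c)}
  let N : E → ℝ := fun z => sInf (A z)
  have hmem : ∀ z (t : ℝ), 0 < t → ∀ s ∈ S, t * (I (t⁻¹ • z + s) - c) ∈ A z :=
    fun z t ht s hs => ⟨t, ht, s, hs, rfl⟩
  have hne : ∀ z, (A z).Nonempty := fun z => ⟨_, hmem z 1 one_pos 0 S.zero_mem⟩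
  have key : ∀ z w (r₁ r₂ : ℝ), r₁ ∈ A z → r₂ ∈ A w → ∃ r ∈ A (z + w), r ≤ r₁ + r₂ := by
    rintro z w _ _ ⟨t, ht, s, hs, rfl⟩ ⟨t', ht', s', hs', rfl⟩
    have htt : 0 < t + t' := by positivity
    refine ⟨_, hmem (z + w) (t + t') htt ((t / (t+t')) • s + (t' / (t + t')) • s')
      (S.add_mem (S.smul_mem _ hs) (S.smul_mem _ hs')), ?_⟩
    have h1 := hI.2 (Set.mem_univ (t⁻¹ • z + s)) (Set.mem_univ (t'⁻¹ • w + s'))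
      (show 0 ≤ t / (t+t') by positivity) (show 0 ≤ t' / (t + t') by positivity) (by field_simp)
    have h2 : (t / (t+t')) • (t⁻¹ • z + s) + (t' / (t + t')) • (t'⁻¹ • w + s') =
      (t + t')⁻¹ • (z + w) + ((t / (t+t')) • s + (t' / (t + t')) • s') := by
      have e1 : t / (t+t') * t⁻¹ = (t+t')⁻¹ := by field_simp
      have e2 : t' / (t+t') * t'⁻¹ = (t+t')⁻¹ := by field_simp
      simp only [smul_add, smul_smul, e1, e2]
      abel
    rw [h2] at h1
    have h3 := mul_le_mul_of_nonneg_left h1 htt.le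
    simp only [smul_eq_mul] at h3
    have h4 : (t + t') * (t / (t + t') * I (t⁻¹ • z + s) + t' / (t + t') * I (t'⁻¹ • w + s'))
      = t * I (t⁻¹ • z + s) + t' * I (t'⁻¹ • w + s') := by field_simp
    rw [h4] at h3
    linarith
  have hSnn : ∀ s ∈ S, ∀ r ∈ A s, 0 ≤ r := by
    rintro s hs _ ⟨t, ht, s', hs', rfl⟩
    have := hc _ (S.add_mem (S.smul_mem t⁻¹ hs) hs')
    exact mul_nonneg ht.le (by linarith)
  have hbdd : ∀ z, BddBelow (A z) := by
    intro z
    obtain ⟨r0, hr0⟩ := hne (-z)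
    refine ⟨-r0, fun r hr => ?_⟩
    obtain ⟨r', hr', hle⟩ := key _ _ _ _ hr hr0
    rw [add_neg_cancel] at hr'
    have := hSnn 0 S.zero_mem _ hr'
    linarith
  have Nadd : ∀ z w, N (z + w) ≤ N z + N w := by
    intro z w
    refine le_of_forall_pos_le_add fun ε hε => ?_
    obtain ⟨r₁, hr₁, h1⟩ := exists_lt_of_csInf_lt (hne z) (show sInf (A z) < N z + ε/2 by
      change N z < _; linarith)
    obtain ⟨r₂, hr₂, h2⟩ := exists_lt_of_csInf_lt (hne w) (show sInf (A w) < N w + ε/2 by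
      change N w < _; linarith)
    obtain ⟨r, hr, hle⟩ := key _ _ _ _ hr₁ hr₂
    have : N (z + w) ≤ r := csInf_le (hbdd _) hr
    linarith
  have Nhom' : ∀ (a : ℝ), 0 < a → ∀ z, N (a • z) ≤ a * N z := by
    intro a ha z
    have : a⁻¹ * N (a • z) ≤ N z := by
      refine le_csInf (hne z) ?_
      rintro _ ⟨t, ht, s, hs, rfl⟩
      have h1 := csInf_le (hbdd (a • z)) (hmem (a • z) (a * t) (by positivity) s hs)
      have h2 : (a * t)⁻¹ • (a • z) = t⁻¹ • z := by
        rw [smul_smul]; congr 1; field_simp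
      rw [h2] at h1
      change N (a • z) ≤ _ at h1
      calc a⁻¹ * N (a • z) ≤ a⁻¹ * (a * t * (I (t⁻¹ • z + s) - c)) := by gcongr
        _ = _ := by field_simp
    calc N (a • z) = a * (a⁻¹ * N (a • z)) := by field_simp
      _ ≤ _ := by gcongr
  have Nhom : ∀ (a : ℝ), 0 < a → ∀ z, N (a • z) = a * N z := by
    intro a ha z
    refine le_antisymm (Nhom' a ha z) ?_
    have := Nhom' a⁻¹ (by positivity) (a • z)
    rw [smul_smul, inv_mul_cancel₀ ha.ne', one_smul] at this
    calc a * N z ≤ a * (a⁻¹ * N (a • z)) := by gcongr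
      _ = _ := by field_simp
  obtain ⟨g, hg1, hg2⟩ := exists_extension_of_le_sublinear
    (⟨S, 0⟩ : E →ₗ.[ℝ] ℝ) N Nhom Nadd (fun x => by
      exact le_csInf (hne _) (hSnn _ x.2))
  refine ⟨g, fun s hs => hg1 ⟨s, hs⟩, fun z => (hg2 z).trans ?_⟩
  have := csInf_le (hbdd z) (hmem z 1 one_pos 0 S.zero_mem)
  simpa using this

/-- corners -/
def corner {T : ℕ} (nt : Fin (T+1) → ℕ) (R : ℝ) : Set (Vec nt) :=
  Set.univ.pi fun _ => Set.univ.pi fun _ => {-R, R}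

theorem corner_finite {T : ℕ} (nt : Fin (T+1) → ℕ) (R : ℝ) : (corner nt R).Finite :=
  Set.Finite.pi fun _ => Set.Finite.pi fun _ => Set.toFinite _

theorem mem_hull_corner {T : ℕ} (nt : Fin (T+1) → ℕ) (R : ℝ) (hR : 0 ≤ R) (z : Vec nt)
    (hz : ‖z‖ ≤ R) : z ∈ convexHull ℝ (corner nt R) := by
  unfold corner
  rw [convexHull_pi]
  intro t _
  change z t ∈ convexHull ℝ _
  rw [convexHull_pi]
  intro i _
  change z t i ∈ convexHull ℝ _
  rw [convexHull_pair, segment_eq_Icc (by linarith)]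
  have h1 := (norm_le_pi_norm (z t) i).trans ((norm_le_pi_norm z t).trans hz)
  rw [Real.norm_eq_abs, abs_le] at h1
  exact h1

theorem measurable_dotN {Ω : Type} [MeasurableSpace Ω] {T : ℕ} {nt : Fin (T+1) → ℕ}
    {x v : Ω → Vec nt} (hx : Measurable x) (hv : Measurable v) :
    Measurable fun ω => dotN nt (x ω) (v ω) := by
  unfold dotN
  fun_prop

theorem dotN_add {T : ℕ} {nt : Fin (T+1) → ℕ} (a b v : Vec nt) :
    dotN nt (a + b) v = dotN nt a v + dotN nt b v := by
  simp [dotN, add_mul, Finset.sum_add_distrib]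

theorem dotN_smul {T : ℕ} {nt : Fin (T+1) → ℕ} (r : ℝ) (a v : Vec nt) :
    dotN nt (r • a) v = r * dotN nt a v := by
  simp [dotN, Finset.mul_sum, mul_assoc]

theorem dotN_neg {T : ℕ} {nt : Fin (T+1) → ℕ} (a v : Vec nt) :
    dotN nt (-a) v = - dotN nt a v := by
  simp [dotN]

theorem dotN_sub {T : ℕ} {nt : Fin (T+1) → ℕ} (a b v : Vec nt) :
    dotN nt (a - b) v = dotN nt a v - dotN nt b v := by
  simp [dotN, sub_mul, Finset.sum_sub_distrib]

theorem Nspace_measurable {Ω : Type} [mΩ : MeasurableSpace Ω] {T : ℕ} {nt : Fin (T+1) → ℕ}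
    {ℱ : Fin (T+1) → MeasurableSpace Ω} (hle : ∀ t, ℱ t ≤ mΩ) {x : Ω → Vec nt}
    (hx : x ∈ Nspace nt ℱ) : Measurable x :=
  measurable_pi_lambda _ fun t => (hx t).mono (hle t) le_rfl

theorem dotN_bound {T : ℕ} {nt : Fin (T+1) → ℕ} (a v : Vec nt) (M : ℝ) (ha : ‖a‖ ≤ M) :
    |dotN nt a v| ≤ M * ∑ t, ∑ i, |v t i| := by
  unfold dotN
  rw [Finset.mul_sum]
  refine (Finset.abs_sum_le_sum_abs _ _).trans (Finset.sum_le_sum fun t _ => ?_)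
  rw [Finset.mul_sum]
  refine (Finset.abs_sum_le_sum_abs _ _).trans (Finset.sum_le_sum fun i _ => ?_)
  rw [abs_mul]
  have h1 := (norm_le_pi_norm (a t) i).trans ((norm_le_pi_norm a t).trans ha)
  rw [Real.norm_eq_abs] at h1
  gcongr

theorem integrable_absv {Ω : Type} [MeasurableSpace Ω] {P : Measure Ω} {T : ℕ}
    {nt : Fin (T+1) → ℕ} {v : Ω → Vec nt} (hv : Integrable v P) :
    Integrable (fun ω => ∑ t, ∑ i, |v ω t i|) P := by
  refine integrable_finsetSum _ fun t _ => integrable_finsetSum _ fun i _ => ?_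
  exact ((hv.eval t).eval i).abs

theorem integrable_dot_of_bdd {Ω : Type} [mΩ : MeasurableSpace Ω] {P : Measure Ω} {T : ℕ}
    {nt : Fin (T+1) → ℕ} {x v : Ω → Vec nt} (hxm : Measurable x) (hvm : Measurable v)
    (hv : Integrable v P) (M : ℝ) (hx : ∀ᵐ ω ∂P, ‖x ω‖ ≤ M) :
    Integrable (fun ω => dotN nt (x ω) (v ω)) P := by
  refine ((integrable_absv hv).const_mul M).mono' (measurable_dotN hxm hvm).aestronglyMeasurable ?_
  filter_upwards [hx] with ω h
  exact dotN_bound _ _ _ h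

open MeasureTheory
open scoped ENNReal

theorem perp_aux {Ω : Type} [mΩ : MeasurableSpace Ω] (P : Measure Ω) [IsProbabilityMeasure P]
    {T : ℕ} {ℱ : Fin (T+1) → MeasurableSpace Ω} (hle : ∀ t, ℱ t ≤ mΩ) (hmono : Monotone ℱ)
    {nt : Fin (T+1) → ℕ} {v : Ω → Vec nt} (hv : v ∈ Nperp nt ℱ P) (d : ℕ) (hd : d ≤ T + 1) :
    ∀ x ∈ Nspace nt ℱ, (∀ t : Fin (T+1), t.val + d < T + 1 → ∀ ω, x ω t = 0) →
      ∀ b : Ω → ℝ, Integrable b P → (∀ᵐ ω ∂P, b ω ≤ dotN nt (x ω) (v ω)) →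
      Integrable (fun ω => dotN nt (x ω) (v ω)) P ∧ ∫ ω, dotN nt (x ω) (v ω) ∂P = 0 := by
  induction d with
  | zero =>
    intro x hx h0 b _ _
    have : ∀ ω, dotN nt (x ω) (v ω) = 0 := fun ω => by
      have h1 : x ω = 0 := funext fun t => h0 t t.is_lt ω
      simp [dotN, h1]
    simp [this]
  | succ d ih =>
    intro x hx h0 b hb hbx
    have ih := ih (by omega)
    obtain ⟨hvm, hvi, hvp⟩ := hv
    have hxm := Nspace_measurable hle hx
    let k : Fin (T+1) := ⟨T - d, by omega⟩
    have hk0 : ∀ t : Fin (T+1), t < k → ∀ ω, x ω t = 0 := by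
      intro t ht ω
      have : t.val < T - d := ht
      exact h0 t (by omega) ω
    let A : ℕ → Set Ω := fun n => {ω | ‖x ω k‖ ≤ n}
    have hAk : ∀ n, MeasurableSet[ℱ k] (A n) := fun n => by
      have h1 : Measurable[ℱ k] fun ω => ‖x ω k‖ := (measurable_norm).comp (hx k)
      exact h1 measurableSet_Iic
    have hA : ∀ n, MeasurableSet (A n) := fun n => hle k _ (hAk n)
    have hcov : AECover P Filter.atTop A := by
      refine ⟨Filter.Eventually.of_forall fun ω => ?_, hA⟩
      obtain ⟨N, hN⟩ := exists_nat_ge ‖x ω k‖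
      filter_upwards [Filter.eventually_ge_atTop N] with n hn
      exact hN.trans (by exact_mod_cast hn)
    have main : ∀ n, IntegrableOn (fun ω => dotN nt (x ω) (v ω)) (A n) P ∧
        ∫ ω in A n, dotN nt (x ω) (v ω) ∂P = 0 := by
      intro n
      classical
      let a : Ω → Vec nt := fun ω t => if t = k then (A n).indicator (fun ω => x ω t) ω else 0
      let c : Ω → Vec nt := fun ω t => if t = k then 0 else (A n).indicator (fun ω => x ω t) ω
      have hsum : ∀ ω, dotN nt (a ω) (v ω) + dotN nt (c ω) (v ω) =
          (A n).indicator (fun ω => dotN nt (x ω) (v ω)) ω := by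
        intro ω
        rw [← dotN_add]
        by_cases hω : ω ∈ A n
        · rw [Set.indicator_of_mem hω]
          congr 1
          funext t
          by_cases ht : t = k <;> simp [a, c, ht, hω]
        · rw [Set.indicator_of_notMem hω]
          have : a ω + c ω = 0 := by
            funext t
            by_cases ht : t = k <;> simp [a, c, ht, hω]
          rw [this]; simp [dotN]
      have haN : a ∈ Nspace nt ℱ := by
        intro t
        by_cases ht : t = k
        · subst ht
          simp only [a, if_true]
          exact (hx _).indicator (hAk n)
        · simp only [a, ht, if_false]
          exact measurable_const
      have hcN : c ∈ Nspace nt ℱ := by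
        intro t
        by_cases ht : t = k
        · simp only [c, ht, if_true]
          exact measurable_const
        · simp only [c, ht, if_false]
          rcases lt_or_gt_of_ne ht with h | h
          · have : ((A n).indicator fun ω => x ω t) = fun _ => 0 := by
              funext ω
              simp [Set.indicator, hk0 t h]
            rw [this]
            exact measurable_const
          · exact (hx _).indicator (hmono h.le _ (hAk n))
      have hab : ∀ ω, ‖a ω‖ ≤ n := by
        intro ω
        rw [pi_norm_le_iff_of_nonneg (by positivity)]
        intro t
        by_cases ht : t = k
        · subst ht
          by_cases hω : ω ∈ A n
          · simp only [a, if_true, Set.indicator_of_mem hω]; exact hω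
          · simp [a, hω]
        · simp [a, ht]
      have hai : Integrable (fun ω => dotN nt (a ω) (v ω)) P :=
        integrable_dot_of_bdd (Nspace_measurable hle haN) hvm hvi n (.of_forall hab)
      have ha0 := hvp a ⟨haN, n, .of_forall hab⟩
      have hc := ih c hcN (by
        intro t ht ω
        by_cases htk : t = k
        · simp [c, htk]
        · have htk' : t.val ≠ T - d := fun h => htk (Fin.ext h)
          simp only [c, htk, if_false, Set.indicator]
          rw [hk0 t (by change t.val < T - d; omega)]; simp)
        (fun ω => -|b ω| - dotN nt (a ω) (v ω)) (hb.abs.neg.sub hai) (by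
          filter_upwards [hbx] with ω h
          have h1 := hsum ω
          by_cases hω : ω ∈ A n
          · rw [Set.indicator_of_mem hω] at h1
            have := neg_abs_le (b ω)
            linarith
          · rw [Set.indicator_of_notMem hω] at h1
            have := abs_nonneg (b ω)
            linarith)
      have e : (A n).indicator (fun ω => dotN nt (x ω) (v ω)) =
        fun ω => dotN nt (a ω) (v ω) + dotN nt (c ω) (v ω) := by
        funext ω; exact (hsum ω).symm
      rw [← integrable_indicator_iff (hA n), ← integral_indicator (hA n), e]
      refine ⟨hai.add hc.1, ?_⟩
      rw [integral_add hai hc.1, ha0, hc.2, add_zero]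
    have hint : Integrable (fun ω => dotN nt (x ω) (v ω)) P := by
      refine hcov.integrable_of_integral_norm_bounded (2 * ∫ ω, |b ω| ∂P) (fun n => (main n).1)
        (Filter.Eventually.of_forall fun n => ?_)
      have h1 : ∫ ω in A n, ‖dotN nt (x ω) (v ω)‖ ∂P ≤
          ∫ ω in A n, (dotN nt (x ω) (v ω) + 2 * |b ω|) ∂P := by
        refine integral_mono_ae (main n).1.norm
          ((main n).1.add (hb.abs.integrableOn.const_mul 2)) (ae_restrict_of_ae ?_)
        filter_upwards [hbx] with ω h
        have := neg_abs_le (b ω)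
        have := abs_nonneg (b ω)
        rw [Real.norm_eq_abs]
        refine abs_le.2 ⟨?_, ?_⟩ <;> linarith
      rw [integral_add (main n).1 (hb.abs.integrableOn.const_mul 2), (main n).2, zero_add] at h1
      refine h1.trans ?_
      rw [integral_const_mul]
      have := setIntegral_le_integral (s := A n) hb.abs (.of_forall fun ω => abs_nonneg _)
      linarith
    refine ⟨hint, ?_⟩
    have := hcov.integral_tendsto_of_countably_generated hint
    simp only [fun n => (main n).2] at this
    exact tendsto_nhds_unique this tendsto_const_nhds

theorem perp_lemma {Ω : Type} [mΩ : MeasurableSpace Ω] (P : Measure Ω) [IsProbabilityMeasure P]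
    {T : ℕ} {ℱ : Fin (T+1) → MeasurableSpace Ω} (hle : ∀ t, ℱ t ≤ mΩ) (hmono : Monotone ℱ)
    {nt : Fin (T+1) → ℕ} {v : Ω → Vec nt} (hv : v ∈ Nperp nt ℱ P)
    (x : Ω → Vec nt) (hx : x ∈ Nspace nt ℱ) (b : Ω → ℝ) (hb : Integrable b P)
    (h : ∀ᵐ ω ∂P, b ω ≤ dotN nt (x ω) (v ω)) :
    Integrable (fun ω => dotN nt (x ω) (v ω)) P ∧ ∫ ω, dotN nt (x ω) (v ω) ∂P = 0 :=
  perp_aux P hle hmono hv (T+1) le_rfl x hx (by omega) b hb h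

open MeasureTheory
open scoped ENNReal

section core
set_option linter.unusedSectionVars false
set_option linter.unusedSimpArgs false
variable {Ω : Type} [mΩ : MeasurableSpace Ω] (P : Measure Ω) [IsProbabilityMeasure P]
  {T : ℕ} {nt : Fin (T+1) → ℕ}

theorem dom_bound (G : Vec nt → Ω → ℝ)
    (hconv : ∀ ω, ConvexOn ℝ Set.univ fun z => G z ω) (hint : ∀ z, Integrable (G z) P)
    (R : ℝ) (hR : 0 ≤ R) :
    ∃ ρ : Ω → ℝ, Integrable ρ P ∧ ∀ z ω, ‖z‖ ≤ R → |G z ω| ≤ ρ ω := by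
  let F := (corner_finite nt R).toFinset
  have hup : ∀ z ω, ‖z‖ ≤ R → G z ω ≤ ∑ q ∈ F, |G q ω| := by
    intro z ω hz
    obtain ⟨q, hq, h⟩ := (hconv ω).exists_ge_of_mem_convexHull (Set.subset_univ _)
      (mem_hull_corner nt R hR z hz)
    have hqF : q ∈ F := by simpa [F] using hq
    exact h.trans ((le_abs_self _).trans
      (Finset.single_le_sum (f := fun q => |G q ω|) (fun _ _ => abs_nonneg _) hqF))
  refine ⟨fun ω => ∑ q ∈ F, |G q ω| + 2 * |G 0 ω|,
    (integrable_finsetSum _ fun q _ => (hint q).abs).add ((hint 0).abs.const_mul 2), ?_⟩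
  intro z ω hz
  have h1 := hup z ω hz
  have h2 := hup (-z) ω (by rwa [norm_neg])
  have h3 := (hconv ω).2 (Set.mem_univ z) (Set.mem_univ (-z)) (show (0:ℝ) ≤ 1/2 by norm_num)
    (show (0:ℝ) ≤ 1/2 by norm_num) (by norm_num)
  have e : (1/2 : ℝ) • z + (1/2 : ℝ) • (-z) = 0 := by simp
  simp only [e, smul_eq_mul] at h3
  have := neg_abs_le (G 0 ω)
  have := abs_nonneg (G 0 ω)
  exact abs_le.2 ⟨by linarith, by linarith⟩

theorem simple_bdd (s : SimpleFunc Ω (Vec nt)) : ∃ R : ℝ, 0 ≤ R ∧ ∀ ω, ‖s ω‖ ≤ R := by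
  obtain ⟨C, hC⟩ := s.exists_forall_norm_le
  exact ⟨max C 0, le_max_right _ _, fun ω => (hC ω).trans (le_max_left _ _)⟩

theorem integrable_G (G : Vec nt → Ω → ℝ)
    (hG : Measurable fun p : Vec nt × Ω => G p.1 p.2)
    (hconv : ∀ ω, ConvexOn ℝ Set.univ fun z => G z ω) (hint : ∀ z, Integrable (G z) P)
    (s : SimpleFunc Ω (Vec nt)) : Integrable (fun ω => G (s ω) ω) P := by
  obtain ⟨R, hR, hs⟩ := simple_bdd s
  obtain ⟨ρ, hρ, h⟩ := dom_bound P G hconv hint R hR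
  exact hρ.mono' (hG.comp (s.measurable.prodMk measurable_id)).aestronglyMeasurable
    (.of_forall fun ω => h _ _ (hs ω))

theorem h_cont (G : Vec nt → Ω → ℝ)
    (hG : Measurable fun p : Vec nt × Ω => G p.1 p.2)
    (hconv : ∀ ω, ConvexOn ℝ Set.univ fun z => G z ω) (hint : ∀ z, Integrable (G z) P)
    (c : ℝ) (h : SimpleFunc Ω (Vec nt) →ₗ[ℝ] ℝ)
    (hh : ∀ s, h s ≤ (∫ ω, G (s ω) ω ∂P) - c)
    {ι : Type} (l : Filter ι) [l.IsCountablyGenerated] (s : ι → SimpleFunc Ω (Vec nt)) (R : ℝ)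
    (hR : 0 ≤ R) (hs : ∀ i ω, ‖s i ω‖ ≤ R)
    (hlim : ∀ᵐ ω ∂P, Filter.Tendsto (fun i => s i ω) l (nhds 0)) :
    Filter.Tendsto (fun i => h (s i)) l (nhds 0) := by
  have hcont : ∀ ω, Continuous fun z => G z ω := fun ω =>
    continuousOn_univ.1 ((hconv ω).continuousOn isOpen_univ)
  have key : ∀ r : ℝ, Filter.Tendsto (fun i => ∫ ω, G (r • s i ω) ω ∂P) l
      (nhds (∫ ω, G 0 ω ∂P)) := by
    intro r
    obtain ⟨ρ, hρ, hb⟩ := dom_bound P G hconv hint (|r| * R) (by positivity)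
    refine tendsto_integral_filter_of_dominated_convergence ρ ?_ ?_ hρ ?_
    · exact .of_forall fun i => (hG.comp
        ((((s i).measurable).const_smul r).prodMk measurable_id)).aestronglyMeasurable
    · refine .of_forall fun i => .of_forall fun ω => hb _ _ ?_
      rw [norm_smul, Real.norm_eq_abs]
      exact mul_le_mul_of_nonneg_left (hs i ω) (abs_nonneg _)
    · filter_upwards [hlim] with ω hω
      have h1 : Filter.Tendsto (fun i => r • s i ω) l (nhds (0 : Vec nt)) := by
        simpa using hω.const_smul r
      exact ((hcont ω).tendsto 0).comp h1
  set D := (∫ ω, G 0 ω ∂P) - c with hD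
  have hD0 : 0 ≤ D := by
    have := hh 0
    simpa [hD] using this
  rw [Metric.tendsto_nhds]
  intro ε hε
  let r : ℝ := (D + 1) / ε + 1
  have hr : 0 < r := by positivity
  have h1 := (key r).eventually (gt_mem_nhds (show ∫ ω, G 0 ω ∂P < D + 1 + c by linarith))
  have h2 := (key (-r)).eventually (gt_mem_nhds (show ∫ ω, G 0 ω ∂P < D + 1 + c by linarith))
  filter_upwards [h1, h2] with i h1 h2
  have e1 := hh (r • s i)
  have e2 := hh ((-r) • s i)
  simp only [map_smul, smul_eq_mul, SimpleFunc.coe_smul, Pi.smul_apply] at e1 e2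
  have hrε : D + 1 < r * ε := by
    simp only [r, add_mul, one_mul, div_mul_cancel₀ _ hε.ne']
    linarith
  rw [Real.dist_eq, sub_zero, abs_lt]
  constructor
  · by_contra hcon
    push Not at hcon
    nlinarith
  · by_contra hcon
    push Not at hcon
    nlinarith

/-- basis vector -/
def bvec (nt : Fin (T+1) → ℕ) (t : Fin (T+1)) (i : Fin (nt t)) : Vec nt :=
  Pi.single t (Pi.single i 1)

theorem bvec_sum (z : Vec nt) : z = ∑ t, ∑ i, z t i • bvec nt t i := by
  classical
  funext t i
  simp only [Finset.sum_apply, bvec, Pi.smul_apply]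
  rw [Finset.sum_eq_single t]
  · rw [Finset.sum_eq_single i]
    · simp
    · intro j _ hj
      simp [Pi.single_apply, hj.symm]
    · simp
  · intro t' _ ht
    refine Finset.sum_eq_zero fun j _ => ?_
    rw [Pi.single_eq_of_ne ht.symm]
    simp
  · simp

/-- indicator simple function -/
noncomputable def indS (A : Set Ω) (hA : MeasurableSet A) (z : Vec nt) : SimpleFunc Ω (Vec nt) :=
  SimpleFunc.piecewise A hA (SimpleFunc.const Ω z) (SimpleFunc.const Ω 0)

open Classical in
theorem indS_apply (A : Set Ω) (hA : MeasurableSet A) (z : Vec nt) (ω : Ω) :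
    indS A hA z ω = if ω ∈ A then z else 0 := by
  simp [indS, SimpleFunc.piecewise_apply]

theorem repr_lemma (G : Vec nt → Ω → ℝ)
    (hG : Measurable fun p : Vec nt × Ω => G p.1 p.2)
    (hconv : ∀ ω, ConvexOn ℝ Set.univ fun z => G z ω) (hint : ∀ z, Integrable (G z) P)
    (c : ℝ) (h : SimpleFunc Ω (Vec nt) →ₗ[ℝ] ℝ)
    (hh : ∀ s, h s ≤ (∫ ω, G (s ω) ω ∂P) - c) :
    ∃ v : Ω → Vec nt, Measurable v ∧ Integrable v P ∧
      ∀ s, h s = ∫ ω, dotN nt (s ω) (v ω) ∂P := by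
  classical
  have hcoord : ∀ z : Vec nt, ∃ g : Ω → ℝ, Measurable g ∧ Integrable g P ∧
      ∀ (A : Set Ω) (hA : MeasurableSet A), h (indS A hA z) = ∫ ω in A, g ω ∂P := by
    intro z
    have hbd : ∀ (A : Set Ω) (hA : MeasurableSet A) ω, ‖indS A hA z ω‖ ≤ ‖z‖ := by
      intro A hA ω
      rw [indS_apply]
      split_ifs <;> simp
    let ν : SignedMeasure Ω :=
      { measureOf' := fun A => if hA : MeasurableSet A then h (indS A hA z) else 0
        empty' := by
          have : indS (∅ : Set Ω) MeasurableSet.empty z = 0 := by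
            ext ω : 1; simp [indS_apply]
          simp [this]
        not_measurable' := fun A hA => by simp [hA]
        m_iUnion' := by
          intro f hf hdis
          have hU := MeasurableSet.iUnion hf
          simp only [hf, hU, dif_pos]
          have hsub : ∀ F : Finset ℕ, h (indS (⋃ i, f i) hU z) - ∑ i ∈ F, h (indS (f i) (hf i) z)
              = h (indS (⋃ i, f i) hU z - ∑ i ∈ F, indS (f i) (hf i) z) := by
            intro F; rw [map_sub, map_sum]
          have hval : ∀ (F : Finset ℕ) ω,
              (indS (⋃ i, f i) hU z - ∑ i ∈ F, indS (f i) (hf i) z : SimpleFunc Ω (Vec nt)) ω =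
              if ∃ i, ω ∈ f i ∧ i ∉ F then z else 0 := by
            intro F ω
            have hs : (∑ i ∈ F, indS (f i) (hf i) z : SimpleFunc Ω (Vec nt)) ω =
                ∑ i ∈ F, indS (f i) (hf i) z ω := by
              induction F using Finset.induction_on with
              | empty => simp
              | insert a F ha ih => rw [Finset.sum_insert ha, Finset.sum_insert ha,
                  SimpleFunc.add_apply, ih]
            rw [SimpleFunc.sub_apply, hs]
            simp only [indS_apply]
            by_cases hω : ∃ i, ω ∈ f i
            · obtain ⟨i, hi⟩ := hω
              have huniq : ∀ j, ω ∈ f j ↔ j = i := by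
                intro j
                refine ⟨fun hj => ?_, fun hj => hj ▸ hi⟩
                by_contra hne
                exact Set.disjoint_left.1 (hdis hne) hj hi
              simp only [huniq, Set.mem_iUnion]
              simp
              split_ifs <;> simp
            · have h0 : ∀ i, ω ∉ f i := by simpa using hω
              simp [h0]
          have := h_cont P G hG hconv hint c h hh (Filter.atTop : Filter (Finset ℕ))
            (fun F => indS (⋃ i, f i) hU z - ∑ i ∈ F, indS (f i) (hf i) z) ‖z‖ (norm_nonneg _)
            (by
              intro F ω
              rw [hval]
              split_ifs <;> simp)
            (by
              refine .of_forall fun ω => ?_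
              simp only [hval]
              refine tendsto_const_nhds.congr' ?_
              by_cases hω : ∃ i, ω ∈ f i
              · obtain ⟨i, hi⟩ := hω
                filter_upwards [Filter.eventually_ge_atTop {i}] with F hF
                rw [if_neg]
                rintro ⟨j, hj, hjF⟩
                have : j ≠ i := by
                  rintro rfl
                  exact hjF (hF (Finset.mem_singleton_self _))
                exact Set.disjoint_left.1 (hdis this) hj hi
              · refine .of_forall fun F => ?_
                have h0 : ∀ i, ω ∉ f i := by simpa using hω
                simp [h0])
          simp only [← hsub] at this
          have h2 := this.const_sub (h (indS (⋃ i, f i) hU z))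
          simpa [HasSum] using h2 }
    have hν : ∀ (A : Set Ω) (hA : MeasurableSet A), ν A = h (indS A hA z) := fun A hA => dif_pos hA
    have hac : ν ≪ᵥ P.toENNRealVectorMeasure := by
      refine VectorMeasure.AbsolutelyContinuous.mk fun A hA h0 => ?_
      rw [Measure.toENNRealVectorMeasure_apply_measurable hA] at h0
      rw [hν A hA]
      have := h_cont P G hG hconv hint c h hh (Filter.atTop : Filter ℕ)
        (fun _ => indS A hA z) ‖z‖ (norm_nonneg _) (fun _ ω => hbd A hA ω) (by
          have : ∀ᵐ ω ∂P, ω ∉ A := measure_eq_zero_iff_ae_notMem.1 h0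
          filter_upwards [this] with ω hω
          simp only [indS_apply, hω, if_false]
          exact tendsto_const_nhds)
      exact tendsto_nhds_unique tendsto_const_nhds this
    refine ⟨ν.rnDeriv P, SignedMeasure.measurable_rnDeriv _ _,
      SignedMeasure.integrable_rnDeriv _ _, fun A hA => ?_⟩
    rw [← hν A hA, ← withDensityᵥ_apply (SignedMeasure.integrable_rnDeriv _ _) hA,
      SignedMeasure.withDensityᵥ_rnDeriv_eq ν P hac]
  choose g hgm hgi hg using hcoord
  let v : Ω → Vec nt := fun ω t i => g (bvec nt t i) ω
  have hvm : Measurable v := by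
    refine measurable_pi_lambda _ fun t => measurable_pi_lambda _ fun i => hgm _
  have hvi : Integrable v P := by
    refine Integrable.of_eval fun t => Integrable.of_eval fun i => hgi _
  refine ⟨v, hvm, hvi, fun s => ?_⟩
  have hsi : ∀ s : SimpleFunc Ω (Vec nt), Integrable (fun ω => dotN nt (s ω) (v ω)) P := by
    intro s
    obtain ⟨R, hR, hs⟩ := simple_bdd s
    exact integrable_dot_of_bdd s.measurable hvm hvi R (.of_forall hs)
  induction s using SimpleFunc.induction with
  | const z hA =>
    rename_i A
    change h (indS A hA z) = ∫ ω, dotN nt (indS A hA z ω) (v ω) ∂P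
    have e1 : indS A hA z = ∑ t, ∑ i, z t i • indS A hA (bvec nt t i) := by
      ext1 ω
      have hs : (∑ t, ∑ i, z t i • indS A hA (bvec nt t i) : SimpleFunc Ω (Vec nt)) ω =
          ∑ t, ∑ i, z t i • indS A hA (bvec nt t i) ω := by
        let ev : SimpleFunc Ω (Vec nt) →+ Vec nt :=
          { toFun := fun s => s ω, map_zero' := rfl, map_add' := fun _ _ => rfl }
        change ev _ = _
        simp only [map_sum]
        rfl
      rw [hs]
      simp only [indS_apply]
      by_cases hω : ω ∈ A
      · simp only [hω, if_true]; exact bvec_sum z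
      · simp [hω]
    have e2 : ∀ ω, dotN nt (indS A hA z ω) (v ω) =
        A.indicator (fun ω => ∑ t, ∑ i, z t i * g (bvec nt t i) ω) ω := by
      intro ω
      rw [indS_apply]
      by_cases hω : ω ∈ A <;> simp [hω, dotN, v]
    simp only [e2]
    rw [integral_indicator hA, integral_finsetSum _ fun t _ => integrable_finsetSum _ fun i _ =>
      ((hgi _).integrableOn.const_mul _)]
    rw [e1, map_sum]
    refine Finset.sum_congr rfl fun t _ => ?_
    rw [integral_finsetSum _ fun i _ => ((hgi _).integrableOn.const_mul _), map_sum]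
    refine Finset.sum_congr rfl fun i _ => ?_
    rw [map_smul, hg, integral_const_mul, smul_eq_mul]
  | add hd hf hg =>
    rw [map_add, hf, hg, ← integral_add (hsi _) (hsi _)]
    refine integral_congr_ae (.of_forall fun ω => ?_)
    simp [dotN_add]

end core

open MeasureTheory
open scoped ENNReal

theorem perp_of_simple {Ω : Type} [mΩ : MeasurableSpace Ω] (P : Measure Ω)
    [IsProbabilityMeasure P] {T : ℕ} {ℱ : Fin (T+1) → MeasurableSpace Ω} (hle : ∀ t, ℱ t ≤ mΩ)
    {nt : Fin (T+1) → ℕ} {v : Ω → Vec nt} (hvm : Measurable v) (hvi : Integrable v P)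
    (h : ∀ s : SimpleFunc Ω (Vec nt), (s : Ω → Vec nt) ∈ Nspace nt ℱ →
      ∫ ω, dotN nt (s ω) (v ω) ∂P = 0) : v ∈ Nperp nt ℱ P := by
  refine ⟨hvm, hvi, ?_⟩
  rintro x ⟨hx, M, hM⟩
  have hM' : ∀ᵐ ω ∂P, ‖x ω‖ ≤ max M 0 := by
    filter_upwards [hM] with ω h
    exact h.trans (le_max_left _ _)
  set M' := max M 0
  have hM0 : 0 ≤ M' := le_max_right _ _
  have hsm : ∀ t, StronglyMeasurable[ℱ t] (fun ω => x ω t) := fun t =>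
    (hx t).stronglyMeasurable
  let a : ℕ → Ω → Vec nt := fun n ω t => (hsm t).approxBounded M' n ω
  have haN : ∀ n, a n ∈ Nspace nt ℱ := fun n t =>
    @SimpleFunc.measurable _ _ (ℱ t) _ ((hsm t).approxBounded M' n)
  have ham : ∀ n, Measurable (a n) := fun n => Nspace_measurable hle (haN n)
  have hafin : ∀ n, (Set.range (a n)).Finite := by
    intro n
    refine (Set.Finite.pi fun t =>
      @SimpleFunc.finite_range _ _ (ℱ t) ((hsm t).approxBounded M' n)).subset ?_
    rintro _ ⟨ω, rfl⟩ t _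
    exact ⟨ω, rfl⟩
  let s : ℕ → SimpleFunc Ω (Vec nt) := fun n =>
    { toFun := a n
      measurableSet_fiber' := fun z => ham n (measurableSet_singleton z)
      finite_range' := hafin n }
  have h0 : ∀ n, ∫ ω, dotN nt (a n ω) (v ω) ∂P = 0 := fun n => h (s n) (haN n)
  have hlim : Filter.Tendsto (fun n => ∫ ω, dotN nt (a n ω) (v ω) ∂P) Filter.atTop
      (nhds (∫ ω, dotN nt (x ω) (v ω) ∂P)) := by
    refine tendsto_integral_filter_of_dominated_convergence
      (fun ω => M' * ∑ t, ∑ i, |v ω t i|) ?_ ?_ ((integrable_absv hvi).const_mul _) ?_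
    · exact .of_forall fun n => (measurable_dotN (ham n) hvm).aestronglyMeasurable
    · refine .of_forall fun n => .of_forall fun ω => dotN_bound _ _ _ ?_
      rw [pi_norm_le_iff_of_nonneg hM0]
      exact fun t => (hsm t).norm_approxBounded_le hM0 n ω
    · filter_upwards [hM'] with ω hω
      unfold dotN
      refine tendsto_finsetSum _ fun t _ => tendsto_finsetSum _ fun i _ => ?_
      refine Filter.Tendsto.mul_const _ ?_
      have := (hsm t).tendsto_approxBounded_of_norm_le ((norm_le_pi_norm (x ω) t).trans hω)
      exact (tendsto_pi_nhds.1 this) i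
  simp only [h0] at hlim
  exact tendsto_nhds_unique hlim tendsto_const_nhds

theorem sup_lemma {Ω : Type} [mΩ : MeasurableSpace Ω] (P : Measure Ω)
    (k : ℕ → Ω → ℝ) (hm : ∀ n, Measurable (k n)) (hi : ∀ n, Integrable (k n) P)
    (hmono : ∀ n ω, k n ω ≤ k (n+1) ω) (c : ℝ) (hc : ∀ n, ∫ ω, k n ω ∂P ≤ c) :
    ∃ K : Ω → ℝ, Integrable K P ∧ (∀ᵐ ω ∂P, ∀ n, k n ω ≤ K ω) ∧ ∫ ω, K ω ∂P ≤ c := by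
  have hmn : ∀ ω, Monotone fun n => k n ω := fun ω => monotone_nat_of_le_succ fun n => hmono n ω
  let g : ℕ → Ω → ℝ≥0∞ := fun n ω => ENNReal.ofReal (k n ω - k 0 ω)
  have hgm : ∀ n, Measurable (g n) := fun n => ((hm n).sub (hm 0)).ennreal_ofReal
  have hgmono : Monotone g := fun a b hab ω =>
    ENNReal.ofReal_le_ofReal (sub_le_sub_right (hmn ω hab) _)
  let S : Ω → ℝ≥0∞ := fun ω => ⨆ n, g n ω
  have hSm : Measurable S := Measurable.iSup hgm
  have hS : ∫⁻ ω, S ω ∂P ≤ ENNReal.ofReal (c - ∫ ω, k 0 ω ∂P) := by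
    rw [lintegral_iSup hgm hgmono]
    refine iSup_le fun n => ?_
    change ∫⁻ ω, ENNReal.ofReal ((k n - k 0) ω) ∂P ≤ _
    rw [← ofReal_integral_eq_lintegral_ofReal ((hi n).sub (hi 0))
      (.of_forall fun ω => sub_nonneg.2 (hmn ω (Nat.zero_le n)))]
    refine ENNReal.ofReal_le_ofReal ?_
    simp only [Pi.sub_apply]
    rw [integral_sub (hi n) (hi 0)]
    linarith [hc n]
  have hfin : ∫⁻ ω, S ω ∂P ≠ ⊤ := ne_top_of_le_ne_top ENNReal.ofReal_ne_top hS
  have hae := ae_lt_top hSm hfin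
  have hSi : Integrable (fun ω => (S ω).toReal) P := integrable_toReal_of_lintegral_ne_top
    hSm.aemeasurable hfin
  refine ⟨fun ω => k 0 ω + (S ω).toReal, (hi 0).add hSi, ?_, ?_⟩
  · filter_upwards [hae] with ω hω n
    have h1 : g n ω ≤ S ω := le_iSup (fun n => g n ω) n
    have h2 := ENNReal.toReal_mono hω.ne h1
    simp only [g] at h2
    rw [ENNReal.toReal_ofReal (sub_nonneg.2 (hmn ω (Nat.zero_le n)))] at h2
    linarith
  · rw [integral_add (hi 0) hSi, integral_toReal hSm.aemeasurable hae]
    have := ENNReal.toReal_mono ENNReal.ofReal_ne_top hS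
    rw [ENNReal.toReal_ofReal (by linarith [hc 0])] at this
    linarith

theorem core_thm {Ω : Type} [mΩ : MeasurableSpace Ω] (P : Measure Ω)
    [IsProbabilityMeasure P] {T : ℕ} {ℱ : Fin (T+1) → MeasurableSpace Ω} (hle : ∀ t, ℱ t ≤ mΩ)
    {nt : Fin (T+1) → ℕ} (G : Vec nt → Ω → ℝ)
    (hG : Measurable fun p : Vec nt × Ω => G p.1 p.2)
    (hconv : ∀ ω, ConvexOn ℝ Set.univ fun z => G z ω) (hint : ∀ z, Integrable (G z) P)
    (c : ℝ) (hc : ∀ s : SimpleFunc Ω (Vec nt), (s : Ω → Vec nt) ∈ Nspace nt ℱ →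
      c ≤ ∫ ω, G (s ω) ω ∂P) :
    ∃ v ∈ Nperp nt ℱ P, ∃ K : Ω → ℝ, Integrable K P ∧ ∫ ω, K ω ∂P ≤ -c ∧
      ∀ᵐ ω ∂P, ∀ z, dotN nt z (v ω) - G z ω ≤ K ω := by
  classical
  let S : Submodule ℝ (SimpleFunc Ω (Vec nt)) :=
    { carrier := {s | (s : Ω → Vec nt) ∈ Nspace nt ℱ}
      add_mem' := fun {a b} ha hb t => (ha t).add (hb t)
      zero_mem' := fun t => measurable_const
      smul_mem' := fun r a ha t => (ha t).const_smul r }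
  have hGi := integrable_G P G hG hconv hint
  have hI : ConvexOn ℝ Set.univ fun s : SimpleFunc Ω (Vec nt) => ∫ ω, G (s ω) ω ∂P := by
    refine ⟨convex_univ, fun s _ s' _ a b ha hb hab => ?_⟩
    simp only [smul_eq_mul]
    rw [← integral_const_mul, ← integral_const_mul,
      ← integral_add ((hGi s).const_mul a) ((hGi s').const_mul b)]
    refine integral_mono (hGi _) (((hGi s).const_mul a).add ((hGi s').const_mul b)) fun ω => ?_
    exact (hconv ω).2 (Set.mem_univ (s ω)) (Set.mem_univ (s' ω)) ha hb hab
  obtain ⟨h, hS0, hh⟩ := hb_lemma _ hI S c hc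
  obtain ⟨v, hvm, hvi, hv⟩ := repr_lemma P G hG hconv hint c h hh
  refine ⟨v, perp_of_simple P hle hvm hvi fun s hs => by rw [← hv, hS0 s hs], ?_⟩
  have hval_m : ∀ s : SimpleFunc Ω (Vec nt), Measurable fun ω =>
      dotN nt (s ω) (v ω) - G (s ω) ω := fun s =>
    (measurable_dotN s.measurable hvm).sub (hG.comp (s.measurable.prodMk measurable_id))
  let q : ℕ → Vec nt := TopologicalSpace.denseSeq _
  let B : SimpleFunc Ω (Vec nt) → ℕ → Set Ω := fun s n =>
    {ω | dotN nt (s ω) (v ω) - G (s ω) ω ≤ dotN nt (q n) (v ω) - G (q n) ω}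
  have hB : ∀ s n, MeasurableSet (B s n) := fun s n =>
    measurableSet_le (hval_m s) (hval_m (SimpleFunc.const Ω (q n)))
  let s : ℕ → SimpleFunc Ω (Vec nt) := fun n => Nat.rec (SimpleFunc.const Ω (q 0))
    (fun n s => SimpleFunc.piecewise (B s n) (hB s n) (SimpleFunc.const Ω (q n)) s) n
  have hs : ∀ n, s (n+1) =
    SimpleFunc.piecewise (B (s n) n) (hB (s n) n) (SimpleFunc.const Ω (q n)) (s n) := fun n => rfl
  let k : ℕ → Ω → ℝ := fun n ω => dotN nt (s n ω) (v ω) - G (s n ω) ω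
  have hk1 : ∀ n ω, k n ω ≤ k (n+1) ω ∧ dotN nt (q n) (v ω) - G (q n) ω ≤ k (n+1) ω := by
    intro n ω
    simp only [k, hs, SimpleFunc.piecewise_apply]
    by_cases hω : ω ∈ B (s n) n
    · simp only [hω, if_true, SimpleFunc.const_apply]
      exact ⟨hω, le_rfl⟩
    · simp only [hω, if_false]
      exact ⟨le_rfl, (not_le.1 hω).le⟩
  have hdi : ∀ s : SimpleFunc Ω (Vec nt), Integrable (fun ω => dotN nt (s ω) (v ω)) P := by
    intro s
    obtain ⟨R, hR, hs⟩ := simple_bdd s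
    exact integrable_dot_of_bdd s.measurable hvm hvi R (.of_forall hs)
  obtain ⟨K, hKi, hKk, hKc⟩ := sup_lemma P k (fun n => hval_m _)
    (fun n => (hdi (s n)).sub (hGi (s n))) (fun n ω => (hk1 n ω).1) (-c) (fun n => by
      simp only [k]
      rw [integral_sub (hdi _) (hGi _), ← hv]
      linarith [hh (s n)])
  refine ⟨K, hKi, hKc, ?_⟩
  filter_upwards [hKk] with ω hω z
  have hcl : IsClosed {z : Vec nt | dotN nt z (v ω) - G z ω ≤ K ω} := by
    have hcont : Continuous fun z => G z ω :=
      continuousOn_univ.1 ((hconv ω).continuousOn isOpen_univ)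
    have : Continuous fun z : Vec nt => dotN nt z (v ω) := by unfold dotN; fun_prop
    exact isClosed_le (this.sub hcont) continuous_const
  have hd : DenseRange q := TopologicalSpace.denseRange_denseSeq _
  exact hd.induction_on (p := fun z => dotN nt z (v ω) - G z ω ≤ K ω) z hcl
    fun n => (hk1 n ω).2.trans (hω (n+1))

open MeasureTheory
open scoped ENNReal

theorem ereal_coe_sum {ι : Type*} (s : Finset ι) (a : ι → ℝ) :
    ((∑ j ∈ s, a j : ℝ) : EReal) = ∑ j ∈ s, (a j : EReal) := by
  classical
  induction s using Finset.induction_on with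
  | empty => simp
  | insert i s hi ih => rw [Finset.sum_insert hi, Finset.sum_insert hi, EReal.coe_add, ih]

theorem epos_coe (r : ℝ) : epos (r : EReal) = ENNReal.ofReal r := by
  simp [epos]

theorem measurable_epos : Measurable epos := by
  unfold epos
  exact Measurable.ite (measurableSet_singleton _) measurable_const
    (measurable_ereal_toReal.ennreal_ofReal)

section
variable {Ω : Type} [mΩ : MeasurableSpace Ω] {P : Measure Ω}

theorem EE_congr {φ ψ : Ω → EReal} (h : φ =ᵐ[P] ψ) : EE P φ = EE P ψ := by
  have h1 : ∫⁻ ω, epos (φ ω) ∂P = ∫⁻ ω, epos (ψ ω) ∂P :=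
    lintegral_congr_ae (by filter_upwards [h] with ω hω; rw [hω])
  have h2 : ∫⁻ ω, epos (-(φ ω)) ∂P = ∫⁻ ω, epos (-(ψ ω)) ∂P :=
    lintegral_congr_ae (by filter_upwards [h] with ω hω; rw [hω])
  unfold EE
  rw [h1, h2]

theorem EE_real {r : Ω → ℝ} (hr : Integrable r P) :
    EE P (fun ω => (r ω : EReal)) = ((∫ ω, r ω ∂P : ℝ) : EReal) := by
  have h1 : ∫⁻ ω, ENNReal.ofReal (r ω) ∂P ≠ ⊤ := hr.lintegral_lt_top.ne
  have h2 : ∫⁻ ω, ENNReal.ofReal (-(r ω)) ∂P ≠ ⊤ := hr.neg.lintegral_lt_top.ne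
  unfold EE
  simp only [← EReal.coe_neg, epos_coe]
  rw [if_neg h1, integral_eq_lintegral_pos_part_sub_lintegral_neg_part hr, EReal.coe_sub,
    EReal.coe_ennreal_toReal h1, EReal.coe_ennreal_toReal h2]

theorem EE_inv {φ : Ω → EReal} (hm : Measurable φ) (h1 : EE P φ ≠ ⊤) (h2 : EE P φ ≠ ⊥) :
    (∀ᵐ ω ∂P, φ ω = ((φ ω).toReal : EReal)) ∧ Integrable (fun ω => (φ ω).toReal) P ∧
      EE P φ = ((∫ ω, (φ ω).toReal ∂P : ℝ) : EReal) := by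
  have hp : ∫⁻ ω, epos (φ ω) ∂P ≠ ⊤ := by
    intro h
    exact h1 (by simp [EE, h])
  have hn : ∫⁻ ω, epos (-(φ ω)) ∂P ≠ ⊤ := by
    intro h
    apply h2
    unfold EE
    rw [if_neg hp, h]
    rw [← EReal.coe_ennreal_toReal hp]
    simp
  have hpm : Measurable fun ω => epos (φ ω) := measurable_epos.comp hm
  have hnm : Measurable fun ω => epos (-(φ ω)) := measurable_epos.comp hm.neg
  have hae : ∀ᵐ ω ∂P, φ ω = ((φ ω).toReal : EReal) := by
    filter_upwards [ae_lt_top hpm hp, ae_lt_top hnm hn] with ω ha hb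
    refine (EReal.coe_toReal ?_ ?_).symm
    · intro h; simp [h, epos] at ha
    · intro h; simp [h, epos] at hb
  have hint : Integrable (fun ω => (φ ω).toReal) P := by
    refine ⟨(measurable_ereal_toReal.comp hm).aestronglyMeasurable, ?_⟩
    rw [hasFiniteIntegral_iff_norm]
    have : ∫⁻ ω, ENNReal.ofReal ‖(φ ω).toReal‖ ∂P ≤
        ∫⁻ ω, (epos (φ ω) + epos (-(φ ω))) ∂P := by
      refine lintegral_mono_ae ?_
      filter_upwards [hae] with ω h
      rw [h, ← EReal.coe_neg, epos_coe, epos_coe, EReal.toReal_coe, Real.norm_eq_abs]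
      rcases abs_cases (φ ω).toReal with ⟨h, _⟩ | ⟨h, _⟩ <;> rw [h]
      · exact le_self_add
      · exact le_add_self
    refine this.trans_lt ?_
    rw [lintegral_add_left hpm]
    exact ENNReal.add_lt_top.2 ⟨hp.lt_top, hn.lt_top⟩
  exact ⟨hae, hint, by rw [EE_congr hae, EE_real hint]⟩

variable {T : ℕ} {nt : Fin (T+1) → ℕ} {m : ℕ}
    {f0 : Vec nt → Ω → EReal} {fj : Fin m → Vec nt → Ω → EReal}

theorem fCon_meas (hf0_meas : Measurable (fun p : Vec nt × Ω => f0 p.1 p.2))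
    (hfj_meas : ∀ j, Measurable (fun p : Vec nt × Ω => fj j p.1 p.2))
    {x : Ω → Vec nt} (hx : Measurable x) {u : Ω → Fin m → ℝ}
    (hu : ∀ j, Measurable fun ω => u ω j) :
    Measurable fun ω => fCon f0 fj (x ω) (u ω) ω := by
  have h1 : ∀ j, Measurable fun ω => fj j (x ω) ω + ((u ω j : ℝ) : EReal) := fun j =>
    ((hfj_meas j).comp (hx.prodMk measurable_id)).add (hu j).coe_real_ereal
  unfold fCon
  refine Measurable.ite ?_ (hf0_meas.comp (hx.prodMk measurable_id)) measurable_const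
  rw [Set.ofPred_forall]
  exact MeasurableSet.iInter fun j => measurableSet_le (h1 j) measurable_const

theorem fcon_facts (hf0_meas : Measurable (fun p : Vec nt × Ω => f0 p.1 p.2))
    (hfj_meas : ∀ j, Measurable (fun p : Vec nt × Ω => fj j p.1 p.2))
    {x : Ω → Vec nt} (hx : Measurable x) {u : Ω → Fin m → ℝ}
    (hu : ∀ j, Measurable fun ω => u ω j)
    (h1 : intF P (fCon f0 fj) x u ≠ ⊤) (h2 : intF P (fCon f0 fj) x u ≠ ⊥) :
    (∀ᵐ ω ∂P, (∀ j, fj j (x ω) ω + ((u ω j : ℝ) : EReal) ≤ 0) ∧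
      f0 (x ω) ω = ((f0 (x ω) ω).toReal : EReal)) ∧
    Integrable (fun ω => (f0 (x ω) ω).toReal) P ∧
    intF P (fCon f0 fj) x u = ((∫ ω, (f0 (x ω) ω).toReal ∂P : ℝ) : EReal) := by
  obtain ⟨hae, hint, hval⟩ := EE_inv (fCon_meas hf0_meas hfj_meas hx hu) h1 h2
  have hfe : ∀ᵐ ω ∂P, (∀ j, fj j (x ω) ω + ((u ω j : ℝ) : EReal) ≤ 0) ∧
      fCon f0 fj (x ω) (u ω) ω = f0 (x ω) ω := by
    filter_upwards [hae] with ω h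
    by_cases hc : ∀ j, fj j (x ω) ω + ((u ω j : ℝ) : EReal) ≤ 0
    · exact ⟨hc, if_pos hc⟩
    · simp only [fCon, if_neg hc] at h
      exact absurd h (EReal.coe_ne_top _).symm
  have e : (fun ω => (fCon f0 fj (x ω) (u ω) ω).toReal) =ᵐ[P] fun ω => (f0 (x ω) ω).toReal := by
    filter_upwards [hfe] with ω h
    rw [h.2]
  refine ⟨?_, hint.congr e, ?_⟩
  · filter_upwards [hfe, hae] with ω h h'
    rw [h.2] at h'
    exact ⟨h.1, h'⟩
  · rw [← integral_congr_ae e]; exact hval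

theorem fcon_val {x : Ω → Vec nt} {u : Ω → Fin m → ℝ} {g : Ω → ℝ} (hg : Integrable g P)
    (h1 : ∀ᵐ ω ∂P, ∀ j, fj j (x ω) ω + ((u ω j : ℝ) : EReal) ≤ 0)
    (h2 : ∀ᵐ ω ∂P, f0 (x ω) ω = (g ω : EReal)) :
    intF P (fCon f0 fj) x u = ((∫ ω, g ω ∂P : ℝ) : EReal) := by
  unfold intF
  rw [← EE_real hg]
  refine EE_congr ?_
  filter_upwards [h1, h2] with ω h h'
  simp only [fCon, if_pos h, h']
end

theorem conv_toReal {V : Type*} [AddCommGroup V] [Module ℝ V] (f : V → EReal)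
    (hb : ∀ x, f x ≠ ⊥) (ht : ∀ x, f x ≠ ⊤)
    (hc : ∀ (a b : ℝ) (x₁ x₂ : V), 0 < a → 0 < b → a + b = 1 →
      f (a • x₁ + b • x₂) ≤ (a : EReal) * f x₁ + (b : EReal) * f x₂) :
    ConvexOn ℝ Set.univ fun z => (f z).toReal := by
  refine convexOn_iff_forall_pos.2 ⟨convex_univ, fun x _ y _ a b ha hb' hab => ?_⟩
  have h := hc a b x y ha hb' hab
  rw [← EReal.coe_toReal (ht x) (hb x), ← EReal.coe_toReal (ht y) (hb y),
    ← EReal.coe_toReal (ht (a • x + b • y)) (hb _)] at h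
  exact_mod_cast h

theorem finite_of_corner {T : ℕ} {nt : Fin (T+1) → ℕ} (f : Vec nt → EReal)
    (hb : ∀ x, f x ≠ ⊥)
    (hc : ∀ (a b : ℝ) (x₁ x₂ : Vec nt), 0 < a → 0 < b → a + b = 1 →
      f (a • x₁ + b • x₂) ≤ (a : EReal) * f x₁ + (b : EReal) * f x₂)
    (hcor : ∀ n : ℕ, ∀ z ∈ corner nt n, f z ≠ ⊤) : ∀ z, f z ≠ ⊤ := by
  have hconv : Convex ℝ {z | f z ≠ ⊤} := by
    refine convex_iff_forall_pos.2 fun x hx y hy a b ha hb' hab => ?_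
    have h := hc a b x y ha hb' hab
    rw [← EReal.coe_toReal hx (hb x), ← EReal.coe_toReal hy (hb y), ← EReal.coe_mul,
      ← EReal.coe_mul, ← EReal.coe_add] at h
    exact ne_top_of_le_ne_top (EReal.coe_ne_top _) h
  intro z
  obtain ⟨n, hn⟩ := exists_nat_ge ‖z‖
  exact convexHull_min (hcor n) hconv (mem_hull_corner nt n (by positivity) z hn)

theorem real_of_feas {a : EReal} {r : ℝ} (ha : a ≠ ⊥) (h : a + (r : EReal) ≤ 0) :
    a = (a.toReal : EReal) := by
  refine (EReal.coe_toReal ?_ ha).symm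
  rintro rfl
  simp at h

open MeasureTheory
open scoped ENNReal

/-- Kuhn–Tucker type optimality conditions for the constrained problem. -/
theorem stmt_13
    {Ω : Type} [mΩ : MeasurableSpace Ω] (P : Measure Ω) [IsProbabilityMeasure P]
    {T : ℕ} (ℱ : Fin (T+1) → MeasurableSpace Ω)
    (hℱ_le : ∀ t, ℱ t ≤ mΩ) (hℱ_mono : Monotone ℱ)
    (nt : Fin (T+1) → ℕ) {m : ℕ}
    -- the convex normal integrands `f_0, f_1, …, f_m`
    (f0 : Vec nt → Ω → EReal) (fj : Fin m → Vec nt → Ω → EReal)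
    (hf0_meas : Measurable (fun p : Vec nt × Ω => f0 p.1 p.2))
    (hfj_meas : ∀ j, Measurable (fun p : Vec nt × Ω => fj j p.1 p.2))
    (hf0_proper : ∀ ω, (∀ x, f0 x ω ≠ ⊥) ∧ ∃ x, f0 x ω ≠ ⊤)
    (hfj_proper : ∀ j ω, (∀ x, fj j x ω ≠ ⊥) ∧ ∃ x, fj j x ω ≠ ⊤)
    (hf0_lsc : ∀ ω, LowerSemicontinuous (fun x => f0 x ω))
    (hfj_lsc : ∀ j ω, LowerSemicontinuous (fun x => fj j x ω))
    (hf0_convex : ∀ (ω : Ω) (a b : ℝ) (x₁ x₂ : Vec nt), 0 < a → 0 < b → a + b = 1 →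
      f0 (a • x₁ + b • x₂) ω ≤ (a : EReal) * f0 x₁ ω + (b : EReal) * f0 x₂ ω)
    (hfj_convex : ∀ (j : Fin m) (ω : Ω) (a b : ℝ) (x₁ x₂ : Vec nt),
      0 < a → 0 < b → a + b = 1 →
      fj j (a • x₁ + b • x₂) ω ≤ (a : EReal) * fj j x₁ ω + (b : EReal) * fj j x₂ ω)
    -- `𝓤₀` and `𝓨₀` are decomposable subspaces in separating duality; `𝓤 = 𝓤₀^m`, `𝓨 = 𝓨₀^m`
    (𝓤₀ 𝓨₀ : Set (Ω → ℝ))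
    (h𝓤₀meas : ∀ u ∈ 𝓤₀, Measurable u) (h𝓨₀meas : ∀ y ∈ 𝓨₀, Measurable y)
    (h𝓤₀sub : ∀ u ∈ 𝓤₀, ∀ u' ∈ 𝓤₀, ∀ c : ℝ, u + u' ∈ 𝓤₀ ∧ c • u ∈ 𝓤₀)
    (h𝓨₀sub : ∀ y ∈ 𝓨₀, ∀ y' ∈ 𝓨₀, ∀ c : ℝ, y + y' ∈ 𝓨₀ ∧ c • y ∈ 𝓨₀)
    (h𝓤₀dec : DecomposableR P 𝓤₀) (h𝓨₀dec : DecomposableR P 𝓨₀)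
    (hpair : ∀ u ∈ 𝓤₀, ∀ y ∈ 𝓨₀, Integrable (fun ω => u ω * y ω) P)
    (hsep𝓤₀ : ∀ u ∈ 𝓤₀, (∀ y ∈ 𝓨₀, ∫ ω, u ω * y ω ∂P = 0) → u =ᵐ[P] (fun _ => 0))
    (hsep𝓨₀ : ∀ y ∈ 𝓨₀, (∀ u ∈ 𝓤₀, ∫ ω, u ω * y ω ∂P = 0) → y =ᵐ[P] (fun _ => 0))
    (𝓤 𝓨 : Set (Ω → Fin m → ℝ))
    (h𝓤 : 𝓤 = {u | ∀ j, (fun ω => u ω j) ∈ 𝓤₀})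
    (h𝓨 : 𝓨 = {y | ∀ j, (fun ω => y ω j) ∈ 𝓨₀})
    -- for every `x ∈ 𝓝^∞` and every `j = 0,…,m`, `ω ↦ f_j(x(ω),ω)` is finite a.e.
    -- and belongs to `𝓤₀`
    (hfin0 : ∀ x ∈ NspaceInf nt ℱ P, ∃ g ∈ 𝓤₀, ∀ᵐ ω ∂P, f0 (x ω) ω = ((g ω : ℝ) : EReal))
    (hfinj : ∀ x ∈ NspaceInf nt ℱ P, ∀ j, ∃ g ∈ 𝓤₀,
      ∀ᵐ ω ∂P, fj j (x ω) ω = ((g ω : ℝ) : EReal))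
    (u : Ω → Fin m → ℝ) (hu : u ∈ 𝓤)
    (hclosed : ∀ x ∈ Nspace nt ℱ, ClosedFn P 𝓤 𝓨 (fun u' => intF P (fCon f0 fj) x u'))
    (hproper : (∀ u' ∈ 𝓤, valueFn P (fCon f0 fj) ℱ u' ≠ ⊥) ∧
      ∃ u' ∈ 𝓤, valueFn P (fCon f0 fj) ℱ u' ≠ ⊤)
    (hsubne : (subdiffFn P 𝓤 𝓨 (valueFn P (fCon f0 fj) ℱ) u).Nonempty) :
    ∀ x ∈ Nspace nt ℱ,
      (intF P (fCon f0 fj) x u = valueFn P (fCon f0 fj) ℱ u ↔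
        (intF P (fCon f0 fj) x u < ⊤ ∧
          ∃ y ∈ 𝓨, ∃ v ∈ Nperp nt ℱ P, ∀ᵐ ω ∂P,
            (∀ j, fj j (x ω) ω + ((u ω j : ℝ) : EReal) ≤ 0) ∧
            (∀ j, 0 ≤ y ω j) ∧
            (∀ j, ((y ω j : ℝ) : EReal) * (fj j (x ω) ω + ((u ω j : ℝ) : EReal)) = 0) ∧
            (∀ z : Vec nt,
              f0 (x ω) ω + (∑ j, ((y ω j : ℝ) : EReal) * fj j (x ω) ω) -
                  ((dotN nt (x ω) (v ω) : ℝ) : EReal) ≤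
                f0 z ω + (∑ j, ((y ω j : ℝ) : EReal) * fj j z ω) -
                  ((dotN nt z (v ω) : ℝ) : EReal)))) := by
  have hxm : ∀ x ∈ Nspace nt ℱ, Measurable x := fun x hx => Nspace_measurable hℱ_le hx
  subst h𝓤 h𝓨
  have hum : ∀ j, Measurable fun ω => u ω j := fun j => h𝓤₀meas _ (hu j)
  have hφle : ∀ x ∈ Nspace nt ℱ, ∀ u', valueFn P (fCon f0 fj) ℱ u' ≤ intF P (fCon f0 fj) x u' :=
    fun x hx u' => iInf₂_le x hx
  obtain ⟨y, hy, hysub⟩ := hsubne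
  have hφbot := hproper.1 u hu
  have hφtop : valueFn P (fCon f0 fj) ℱ u ≠ ⊤ := by
    intro h
    obtain ⟨u', hu', hne⟩ := hproper.2
    have := hysub u' hu'
    rw [h, EReal.top_add_coe] at this
    exact hne (top_le_iff.1 this)
  obtain ⟨c0, hc0⟩ : ∃ c0 : ℝ, valueFn P (fCon f0 fj) ℱ u = (c0 : EReal) :=
    ⟨_, (EReal.coe_toReal hφtop hφbot).symm⟩
  have hneb : ∀ x ∈ Nspace nt ℱ, intF P (fCon f0 fj) x u ≠ ⊥ := fun x hx h =>
    hφbot (le_bot_iff.1 (h ▸ hφle x hx u))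
  intro x hx
  constructor
  swap
  · -- sufficiency
    rintro ⟨hlt, y, hy, v, hv, hall⟩
    refine le_antisymm ?_ (hφle x hx u)
    refine le_iInf₂ fun x' hx' => ?_
    by_cases htop : intF P (fCon f0 fj) x' u = ⊤
    · rw [htop]; exact le_top
    obtain ⟨ha, hi, he⟩ := fcon_facts hf0_meas hfj_meas (hxm x hx) hum hlt.ne (hneb x hx)
    obtain ⟨ha', hi', he'⟩ := fcon_facts hf0_meas hfj_meas (hxm x' hx') hum htop (hneb x' hx')
    rw [he, he', EReal.coe_le_coe_iff]
    have hineq : ∀ᵐ ω ∂P, (f0 (x ω) ω).toReal - (f0 (x' ω) ω).toReal ≤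
        dotN nt ((x - x') ω) (v ω) := by
      filter_upwards [ha, ha', hall] with ω h1 h2 h3
      obtain ⟨hfe, h0⟩ := h1
      obtain ⟨hfe', h0'⟩ := h2
      obtain ⟨-, hy0, hsl, hmin⟩ := h3
      have hm := hmin (x' ω)
      have r1 : ∀ j, fj j (x ω) ω = ((fj j (x ω) ω).toReal : EReal) := fun j =>
        real_of_feas ((hfj_proper j ω).1 _) (hfe j)
      have r2 : ∀ j, fj j (x' ω) ω = ((fj j (x' ω) ω).toReal : EReal) := fun j =>
        real_of_feas ((hfj_proper j ω).1 _) (hfe' j)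
      have e1 : (∑ j, ((y ω j : ℝ) : EReal) * fj j (x ω) ω) =
          ((∑ j, y ω j * (fj j (x ω) ω).toReal : ℝ) : EReal) := by
        rw [ereal_coe_sum]
        exact Finset.sum_congr rfl fun j _ => by rw [EReal.coe_mul, ← r1 j]
      have e2 : (∑ j, ((y ω j : ℝ) : EReal) * fj j (x' ω) ω) =
          ((∑ j, y ω j * (fj j (x' ω) ω).toReal : ℝ) : EReal) := by
        rw [ereal_coe_sum]
        exact Finset.sum_congr rfl fun j _ => by rw [EReal.coe_mul, ← r2 j]
      rw [e1, e2, h0, h0'] at hm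
      norm_cast at hm
      have e3 : ∑ j, y ω j * (fj j (x' ω) ω).toReal ≤ ∑ j, y ω j * (fj j (x ω) ω).toReal := by
        refine Finset.sum_le_sum fun j _ => ?_
        have s1 := hsl j
        have s2 := hfe' j
        rw [r1 j] at s1
        rw [r2 j] at s2
        norm_cast at s1 s2
        have := mul_nonneg (hy0 j) (neg_nonneg.2 s2)
        nlinarith
      rw [Pi.sub_apply, dotN_sub]
      linarith
    have hN : x - x' ∈ Nspace nt ℱ := fun t => (hx t).sub (hx' t)
    obtain ⟨hd, hd0⟩ := perp_lemma P hℱ_le hℱ_mono hv _ hN _ (hi.sub hi') hineq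
    have := integral_mono_ae (hi.sub hi') hd hineq
    rw [hd0] at this
    simp only [Pi.sub_apply] at this
    rw [integral_sub hi hi'] at this
    linarith
  -- necessity
  intro hsol
  have hlt : intF P (fCon f0 fj) x u ≠ ⊤ := by rw [hsol]; exact hφtop
  refine ⟨hlt.lt_top, y, hy, ?_⟩
  obtain ⟨ha, hi, he⟩ := fcon_facts hf0_meas hfj_meas (hxm x hx) hum hlt (hneb x hx)
  have hc0' : ∫ ω, (f0 (x ω) ω).toReal ∂P = c0 := by
    rw [hsol, hc0] at he
    exact_mod_cast he.symm
  -- bounded functions belong to the spaces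
  have hconstN : ∀ z : Vec nt, (fun _ => z) ∈ NspaceInf nt ℱ P := fun z =>
    ⟨fun t => measurable_const, ‖z‖, .of_forall fun _ => le_rfl⟩
  have hbU : ∀ g : Ω → ℝ, Measurable g → (∃ M : ℝ, ∀ᵐ ω ∂P, |g ω| ≤ M) → g ∈ 𝓤₀ := by
    intro g hg hM
    obtain ⟨g0, hg0, -⟩ := hfin0 _ (hconstN 0)
    have := h𝓤₀dec ∅ MeasurableSet.empty g0 hg0 g hg hM
    simpa using this
  have hneY : 𝓨₀.Nonempty := by
    by_contra hne
    rw [Set.not_nonempty_iff_eq_empty] at hne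
    have := hsep𝓤₀ (fun _ => 1) (hbU _ measurable_const ⟨1, by simp⟩) (by simp [hne])
    obtain ⟨ω, hω⟩ := this.exists
    simp at hω
  have hbY : ∀ g : Ω → ℝ, Measurable g → (∃ M : ℝ, ∀ᵐ ω ∂P, |g ω| ≤ M) → g ∈ 𝓨₀ := by
    intro g hg hM
    obtain ⟨g0, hg0⟩ := hneY
    have := h𝓨₀dec ∅ MeasurableSet.empty g0 hg0 g hg hM
    simpa using this
  have hUint : ∀ g ∈ 𝓤₀, Integrable g P := fun g hg => by
    simpa using hpair g hg (fun _ => 1) (hbY _ measurable_const ⟨1, by simp⟩)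
  have hYint : ∀ g ∈ 𝓨₀, Integrable g P := fun g hg => by
    simpa using hpair (fun _ => 1) (hbU _ measurable_const ⟨1, by simp⟩) g hg
  have hym : ∀ j, Measurable fun ω => y ω j := fun j => h𝓨₀meas _ (hy j)
  have hval : ∀ u' ∈ {u : Ω → Fin m → ℝ | ∀ j, (fun ω => u ω j) ∈ 𝓤₀}, ∀ x' ∈ Nspace nt ℱ,
      ∀ g : Ω → ℝ, Integrable g P →
      (∀ᵐ ω ∂P, ∀ j, fj j (x' ω) ω + ((u' ω j : ℝ) : EReal) ≤ 0) →
      (∀ᵐ ω ∂P, f0 (x' ω) ω = (g ω : EReal)) → c0 + pairing P (u' - u) y ≤ ∫ ω, g ω ∂P := by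
    intro u' hu' x' hx' g hg h1 h2
    have h3 := (hysub u' hu').trans (hφle x' hx' u')
    rw [fcon_val hg h1 h2, hc0] at h3
    exact_mod_cast h3
  have hone : ∀ j, ∀ w ∈ 𝓤₀,
      (∀ᵐ ω ∂P, fj j (x ω) ω + ((u ω j + w ω : ℝ) : EReal) ≤ 0) →
      ∫ ω, w ω * y ω j ∂P ≤ 0 := by
    intro j w hw hfe
    classical
    let u' : Ω → Fin m → ℝ := fun ω i => if i = j then u ω i + w ω else u ω i
    have hu' : u' ∈ {u : Ω → Fin m → ℝ | ∀ j, (fun ω => u ω j) ∈ 𝓤₀} := by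
      intro i
      by_cases hij : i = j
      · simp only [u', hij, if_true]
        exact (h𝓤₀sub _ (hu j) w hw 1).1
      · simp only [u', hij, if_false]
        exact hu i
    have h1 := hval u' hu' x hx _ hi (by
      filter_upwards [hfe, ha] with ω h h' i
      by_cases hij : i = j
      · subst hij
        simpa [u'] using h
      · simpa [u', hij] using h'.1 i) (by filter_upwards [ha] with ω h using h.2)
    have h2 : pairing P (u' - u) y = ∫ ω, w ω * y ω j ∂P := by
      unfold pairing
      refine integral_congr_ae (.of_forall fun ω => ?_)
      simp only [dotM, Pi.sub_apply]
      rw [Finset.sum_eq_single j]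
      · simp [u']
      · intro i _ hij; simp [u', hij]
      · simp
    rw [h2, hc0'] at h1
    linarith
  have hy0 : ∀ᵐ ω ∂P, ∀ j, 0 ≤ y ω j := by
    rw [ae_all_iff]
    intro j
    refine ae_nonneg_of_forall_setIntegral_nonneg (hYint _ (hy j)) fun A hA _ => ?_
    have h1 := hone j (A.indicator fun _ => -1) (hbU _ (measurable_const.indicator hA)
      ⟨1, .of_forall fun ω => by by_cases h : ω ∈ A <;> simp [h]⟩) (by
        filter_upwards [ha] with ω h
        refine le_trans ?_ (h.1 j)
        gcongr
        by_cases h : ω ∈ A <;> simp [h])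
    have h2 : ∀ ω, A.indicator (fun _ => (-1:ℝ)) ω * y ω j = A.indicator (fun ω => - y ω j) ω := by
      intro ω
      by_cases h : ω ∈ A <;> simp [h]
    simp only [h2] at h1
    rw [integral_indicator hA, integral_neg] at h1
    linarith
  have hslack : ∀ᵐ ω ∂P, ∀ j, y ω j * ((fj j (x ω) ω).toReal + u ω j) = 0 := by
    rw [ae_all_iff]
    intro j
    let g : Ω → ℝ := fun ω => (fj j (x ω) ω).toReal + u ω j
    have hgm : Measurable g :=
      (measurable_ereal_toReal.comp ((hfj_meas j).comp ((hxm x hx).prodMk measurable_id))).add (hum j)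
    have hg0 : ∀ᵐ ω ∂P, g ω ≤ 0 ∧ fj j (x ω) ω = ((fj j (x ω) ω).toReal : EReal) := by
      filter_upwards [ha] with ω h
      have h1 := h.1 j
      have h2 := real_of_feas ((hfj_proper j ω).1 _) h1
      rw [h2] at h1
      refine ⟨by exact_mod_cast h1, h2⟩
    have hA : ∀ n : ℕ, MeasurableSet {ω | |g ω| ≤ n} := fun n =>
      measurableSet_le hgm.abs measurable_const
    have key : ∀ n : ℕ, ∀ᵐ ω ∂P, |g ω| ≤ n → y ω j * g ω = 0 := by
      intro n
      set A := {ω | |g ω| ≤ (n:ℝ)} with hAdef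
      have hwU : A.indicator (fun ω => - g ω) ∈ 𝓤₀ :=
        hbU _ (hgm.neg.indicator (hA n)) ⟨n, .of_forall fun ω => by
          by_cases h : ω ∈ A
          · rw [Set.indicator_of_mem h, abs_neg]; exact h
          · simp [h]⟩
      have h1 := hone j _ hwU (by
          filter_upwards [ha, hg0] with ω h h'
          by_cases hω : ω ∈ A
          · rw [Set.indicator_of_mem hω, h'.2]
            norm_cast
            simp only [g]
            linarith
          · rw [Set.indicator_of_notMem hω, add_zero]
            exact h.1 j)
      have hnn : 0 ≤ᵐ[P] fun ω => A.indicator (fun ω => - g ω) ω * y ω j := by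
        filter_upwards [hy0, hg0] with ω h h'
        refine mul_nonneg ?_ (h j)
        by_cases hω : ω ∈ A
        · rw [Set.indicator_of_mem hω]; linarith [h'.1]
        · rw [Set.indicator_of_notMem hω]
      have h3 := (integral_eq_zero_iff_of_nonneg_ae hnn (hpair _ hwU _ (hy j))).1
        (le_antisymm h1 (integral_nonneg_of_ae hnn))
      filter_upwards [h3] with ω h hω
      have hω' : ω ∈ A := hω
      simp only [Set.indicator_of_mem hω', Pi.zero_apply] at h
      linarith
    rw [← ae_all_iff] at key
    filter_upwards [key] with ω h
    obtain ⟨n, hn⟩ := exists_nat_ge |g ω|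
    exact h n hn
  -- the good set
  have hgood : ∀ᵐ ω ∂P, (∀ j, 0 ≤ y ω j) ∧
      (∀ z, f0 z ω ≠ ⊤) ∧ (∀ j z, fj j z ω ≠ ⊤) := by
    have g1 : ∀ᵐ ω ∂P, ∀ n : ℕ, ∀ z ∈ corner nt n, f0 z ω ≠ ⊤ := by
      rw [ae_all_iff]
      intro n
      rw [ae_ball_iff (corner_finite nt n).countable]
      intro z _
      obtain ⟨g, -, hg⟩ := hfin0 _ (hconstN z)
      filter_upwards [hg] with ω h
      rw [h]; exact EReal.coe_ne_top _
    have g2 : ∀ᵐ ω ∂P, ∀ j, ∀ n : ℕ, ∀ z ∈ corner nt n, fj j z ω ≠ ⊤ := by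
      rw [ae_all_iff]
      intro j
      rw [ae_all_iff]
      intro n
      rw [ae_ball_iff (corner_finite nt n).countable]
      intro z _
      obtain ⟨g, -, hg⟩ := hfinj _ (hconstN z) j
      filter_upwards [hg] with ω h
      rw [h]; exact EReal.coe_ne_top _
    filter_upwards [hy0, g1, g2] with ω h1 h2 h3
    exact ⟨h1, finite_of_corner _ (hf0_proper ω).1 (hf0_convex ω) h2,
      fun j => finite_of_corner _ (hfj_proper j ω).1 (hfj_convex j ω) (h3 j)⟩
  obtain ⟨Ω0, hΩ0m, hΩ0ae, hΩ0⟩ : ∃ Ω0 : Set Ω, MeasurableSet Ω0 ∧ (∀ᵐ ω ∂P, ω ∈ Ω0) ∧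
      ∀ ω ∈ Ω0, (∀ j, 0 ≤ y ω j) ∧ (∀ z, f0 z ω ≠ ⊤) ∧ (∀ j z, fj j z ω ≠ ⊤) := by
    obtain ⟨s, hs, hsm, hs0⟩ := exists_measurable_superset_of_null (ae_iff.1 hgood)
    refine ⟨sᶜ, hsm.compl, measure_eq_zero_iff_ae_notMem.1 hs0, fun ω hω => ?_⟩
    by_contra hcon
    exact hω (hs hcon)
  classical
  let G : Vec nt → Ω → ℝ := fun z ω =>
    if ω ∈ Ω0 then (f0 z ω).toReal + ∑ j, y ω j * (fj j z ω).toReal else 0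
  have hGm : Measurable fun p : Vec nt × Ω => G p.1 p.2 := by
    refine Measurable.ite (measurable_snd hΩ0m) ?_ measurable_const
    refine (measurable_ereal_toReal.comp hf0_meas).add (Finset.measurable_sum _ fun j _ => ?_)
    exact ((hym j).comp measurable_snd).mul (measurable_ereal_toReal.comp (hfj_meas j))
  have hGconv : ∀ ω, ConvexOn ℝ Set.univ fun z => G z ω := by
    intro ω
    by_cases hω : ω ∈ Ω0
    · simp only [G, hω, if_true]
      obtain ⟨h1, h2, h3⟩ := hΩ0 ω hω
      refine (conv_toReal _ (hf0_proper ω).1 h2 (hf0_convex ω)).add ?_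
      have hs : ∀ s : Finset (Fin m), ConvexOn ℝ Set.univ
          fun z => ∑ j ∈ s, y ω j * (fj j z ω).toReal := by
        intro s
        induction s using Finset.induction_on with
        | empty => simpa using convexOn_const 0 convex_univ
        | insert j s hj ih =>
          simp only [Finset.sum_insert hj]
          exact ((conv_toReal _ (hfj_proper j ω).1 (h3 j) (hfj_convex j ω)).smul (h1 j)).add ih
      exact hs _
    · simp only [G, hω, if_false]
      exact convexOn_const 0 convex_univ
  have hGx : ∀ x' ∈ NspaceInf nt ℱ P, Integrable (fun ω => G (x' ω) ω) P ∧
      c0 - pairing P u y ≤ ∫ ω, G (x' ω) ω ∂P := by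
    intro x' hx'
    obtain ⟨g0, hg0, hg0e⟩ := hfin0 x' hx'
    choose g hg hge using hfinj x' hx'
    have e : (fun ω => G (x' ω) ω) =ᵐ[P] fun ω => g0 ω + ∑ j, g j ω * y ω j := by
      filter_upwards [hΩ0ae, hg0e, ae_all_iff.2 hge] with ω h1 h2 h3
      simp [G, h1, h2, h3, mul_comm]
    have i1 : Integrable (fun ω => ∑ j, g j ω * y ω j) P :=
      integrable_finsetSum _ fun j _ => hpair _ (hg j) _ (hy j)
    have i2 : Integrable (fun ω => ∑ j, u ω j * y ω j) P :=
      integrable_finsetSum _ fun j _ => hpair _ (hu j) _ (hy j)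
    have i0 := hUint g0 hg0
    refine ⟨(i0.add i1).congr e.symm, ?_⟩
    rw [integral_congr_ae e, integral_add i0 i1]
    have h1 := hval (fun ω j => - g j ω) (fun j => by
        have h3 := (h𝓤₀sub _ (hg j) _ (hg j) (-1)).2
        rw [neg_one_smul] at h3
        exact h3) x' hx'.1 g0 i0 (by
        filter_upwards [ae_all_iff.2 hge] with ω h j
        rw [h j]
        norm_cast
        simp) hg0e
    have h2 : pairing P ((fun ω j => - g j ω) - u) y =
        - (∫ ω, ∑ j, g j ω * y ω j ∂P) - pairing P u y := by
      unfold pairing dotM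
      have i1n : Integrable (fun ω => -∑ j, g j ω * y ω j) P := i1.neg
      rw [← integral_neg, ← integral_sub i1n i2]
      refine integral_congr_ae (.of_forall fun ω => ?_)
      simp [sub_mul, Finset.sum_sub_distrib]
    rw [h2] at h1
    linarith
  obtain ⟨v, hv, K, hKi, hKc, hK⟩ := core_thm P hℱ_le G hGm hGconv
    (fun z => (hGx _ (hconstN z)).1) (c0 - pairing P u y) (fun s hs => by
      obtain ⟨R, -, hR⟩ := simple_bdd s
      exact (hGx s ⟨hs, R, .of_forall hR⟩).2)
  refine ⟨v, hv, ?_⟩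
  have i2 : Integrable (fun ω => ∑ j, u ω j * y ω j) P :=
    integrable_finsetSum _ fun j _ => hpair _ (hu j) _ (hy j)
  have eG : (fun ω => G (x ω) ω) =ᵐ[P]
      fun ω => (f0 (x ω) ω).toReal - ∑ j, u ω j * y ω j := by
    filter_upwards [hΩ0ae, hslack] with ω h1 h2
    simp only [G, h1, if_true]
    rw [sub_eq_add_neg, ← Finset.sum_neg_distrib]
    congr 1
    refine Finset.sum_congr rfl fun j _ => ?_
    linarith [h2 j]
  have hGi : Integrable (fun ω => G (x ω) ω) P := (hi.sub i2).congr eG.symm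
  have hGI : ∫ ω, G (x ω) ω ∂P = c0 - pairing P u y := by
    rw [integral_congr_ae eG, integral_sub hi i2, hc0']
    rfl
  have hxneg : (-x) ∈ Nspace nt ℱ := fun t => (hx t).neg
  obtain ⟨hd, hd0⟩ := perp_lemma P hℱ_le hℱ_mono hv _ hxneg (fun ω => -(G (x ω) ω) - K ω)
    (hGi.neg.sub hKi) (by
      filter_upwards [hK] with ω h
      have := h (x ω)
      rw [Pi.neg_apply, dotN_neg]
      linarith)
  have htot : ∫ ω, (K ω + G (x ω) ω + dotN nt ((-x) ω) (v ω)) ∂P ≤ 0 := by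
    have hKG : Integrable (fun ω => K ω + G (x ω) ω) P := hKi.add hGi
    rw [integral_add hKG hd, integral_add hKi hGi, hd0, hGI]
    linarith
  have hnn : 0 ≤ᵐ[P] fun ω => K ω + G (x ω) ω + dotN nt ((-x) ω) (v ω) := by
    filter_upwards [hK] with ω h
    have := h (x ω)
    rw [Pi.neg_apply, dotN_neg, Pi.zero_apply]
    linarith
  have hzero := (integral_eq_zero_iff_of_nonneg_ae hnn ((hKi.add hGi).add hd)).1
    (le_antisymm htot (integral_nonneg_of_ae hnn))
  filter_upwards [ha, hy0, hslack, hΩ0ae, hK, hzero] with ω h1 h2 h3 h4 h5 h6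
  obtain ⟨-, g2, g3⟩ := hΩ0 ω h4
  have r0 : ∀ z, f0 z ω = ((f0 z ω).toReal : EReal) := fun z =>
    (EReal.coe_toReal (g2 z) ((hf0_proper ω).1 z)).symm
  have rj : ∀ j z, fj j z ω = ((fj j z ω).toReal : EReal) := fun j z =>
    (EReal.coe_toReal (g3 j z) ((hfj_proper j ω).1 z)).symm
  have eL : ∀ z, f0 z ω + (∑ j, ((y ω j : ℝ) : EReal) * fj j z ω) -
      ((dotN nt z (v ω) : ℝ) : EReal) = ((G z ω - dotN nt z (v ω) : ℝ) : EReal) := by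
    intro z
    have : (∑ j, ((y ω j : ℝ) : EReal) * fj j z ω) =
        ((∑ j, y ω j * (fj j z ω).toReal : ℝ) : EReal) := by
      rw [ereal_coe_sum]
      exact Finset.sum_congr rfl fun j _ => by rw [EReal.coe_mul, ← rj j]
    rw [this, r0 z]
    simp only [G, h4, if_true]
    norm_cast
  refine ⟨h1.1, h2, fun j => ?_, fun z => ?_⟩
  · rw [rj j (x ω)]
    exact_mod_cast h3 j
  · rw [eL, eL, EReal.coe_le_coe_iff]
    have := h5 z
    rw [Pi.neg_apply, dotN_neg, Pi.zero_apply] at h6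
    linarith
end
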